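/- Comparison principle (Theorem 2.9): Under the standing setting (complete geodesic metric space (E,d), proper lower semicontinuous energy 𝓔, an EVI_κ gradient flow S of 𝓔 on E, and the regularized-geodesics assumption), let λ>0 and let h†,h‡ : E → ℝ be bounded and uniformly continuous. If u : E → ℝ is a viscosity subsolution of f − λH†f = h† and v : E → ℝ is a viscosity supersolution of f − λH‡f = h‡, then sup_{π∈E} (u(π) − v(π)) ≤ sup_{π∈E} (h†(π) − h‡(π)). -/

import Mathlib

open Filter Topology MeasureTheory
open scoped ENNReal

noncomputable section

/-- Upper right Dini derivative (EReal-valued). -/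
def diniUR (φ : ℝ → ℝ) (t : ℝ) : EReal :=
  Filter.limsup (fun h : ℝ => (((φ (t + h) - φ t) / h : ℝ) : EReal)) (𝓝[>] (0 : ℝ))

/-- A geodesic metric space: any two points are joined by a constant speed geodesic. -/
def GeodesicSpace (E : Type*) [MetricSpace E] : Prop :=
  ∀ ρ π : E, ∃ γ : ℝ → E, γ 0 = ρ ∧ γ 1 = π ∧
    ∀ s ∈ Set.Icc (0:ℝ) 1, ∀ t ∈ Set.Icc (0:ℝ) 1,
      dist (γ s) (γ t) = |t - s| * dist ρ π

/-- A continuous curve `γ : [0,∞) → E` with `γ((0,∞)) ⊆ D(𝓔)` solving the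
evolution variational inequality EVI_κ. -/
def IsEVISolution {E : Type*} [MetricSpace E] (En : E → EReal) (κ : ℝ) (γ : ℝ → E) : Prop :=
  ContinuousOn γ (Set.Ici (0:ℝ)) ∧
  (∀ t : ℝ, 0 < t → En (γ t) < ⊤) ∧
  ∀ ρ : E, En ρ < ⊤ → ∀ t : ℝ, 0 ≤ t →
    (1/2 : EReal) * diniUR (fun s => dist (γ s) ρ ^ 2) t ≤
      En ρ - En (γ t) - ((κ / 2 * dist (γ t) ρ ^ 2 : ℝ) : EReal)

/-- An EVI_κ gradient flow of `En` defined on all of `E`. -/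
structure IsEVIFlow {E : Type*} [MetricSpace E] (En : E → EReal) (κ : ℝ) (S : ℝ → E → E) : Prop where
  cont : ∀ t : ℝ, 0 ≤ t → Continuous (S t)
  id0 : ∀ π : E, S 0 π = π
  semigroup : ∀ (π : E) (s t : ℝ), 0 ≤ s → 0 ≤ t → S (t + s) π = S s (S t π)
  evi : ∀ π : E, IsEVISolution En κ (fun t => S t π)

open Classical in
/-- The local slope `|∂𝓔|(ρ)`. -/
def localSlope {E : Type*} [MetricSpace E] (En : E → EReal) (ρ : E) : ℝ≥0∞ :=
  if En ρ = ⊤ then ⊤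
  else Filter.limsup (fun π : E => ENNReal.ofReal ((En ρ - En π).toReal / dist ρ π)) (𝓝[≠] ρ)

/-- The information functional `I = |∂𝓔|²`. -/
def info {E : Type*} [MetricSpace E] (En : E → EReal) (π : E) : ℝ≥0∞ := (localSlope En π) ^ 2

/-- The (modified) Tataru distance `d_T(π,ρ) = inf_{t ≥ 0} { t + e^{κ̂ t} d(π, S(t)ρ) }`,
where `κ̂ = min κ 0`. -/
def tataru {E : Type*} [MetricSpace E] (S : ℝ → E → E) (κ : ℝ) (π ρ : E) : ℝ :=
  sInf {x : ℝ | ∃ t : ℝ, 0 ≤ t ∧ x = t + Real.exp (min κ 0 * t) * dist π (S t ρ)}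

end

noncomputable section

/-- Assumption 2.8: regularized geodesics. -/
def RegularizedGeodesics {E : Type*} [MetricSpace E] (En : E → EReal) : Prop :=
  ∀ ρ π : E, info En ρ < ⊤ → En π < ⊤ →
    ∃ γ : ℝ → E, γ 0 = ρ ∧ γ 1 = π ∧
      (∀ s ∈ Set.Icc (0:ℝ) 1, ∀ t ∈ Set.Icc (0:ℝ) 1,
        dist (γ s) (γ t) = |t - s| * dist ρ π) ∧
      ∀ θ : ℝ, 0 < θ → ∃ τ : ℝ, 0 < τ ∧ ∃ γθ : ℝ → E,
        Filter.limsup (fun t : ℝ => ((dist (γθ t) (γ t) / t : ℝ) : EReal)) (𝓝[>] (0:ℝ))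
          ≤ ((θ : ℝ) : EReal) ∧
        Filter.liminf (fun t : ℝ => (En (γθ t) - En ρ) * (((1 / t : ℝ)) : EReal)) (𝓝[>] (0:ℝ))
          ≤ ((localSlope En ρ : ℝ≥0∞) : EReal) * ((dist ρ π + θ : ℝ) : EReal)

/-- The test function `f† = (a/2) d²(·,ρ) + b d_T(·,μ) + c`. -/
def fDag {E : Type*} [MetricSpace E] (S : ℝ → E → E) (κ : ℝ)
    (a b c : ℝ) (μ ρ : E) (π : E) : ℝ :=
  a / 2 * dist π ρ ^ 2 + b * tataru S κ π μ + c

/-- The upper bound `g†` for the Hamiltonian on `f†`. -/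
def gDag {E : Type*} [MetricSpace E] (En : E → EReal) (κ : ℝ)
    (a b : ℝ) (ρ : E) (π : E) : EReal :=
  ((a : ℝ) : EReal) * (En ρ - En π) +
    ((-(a * (κ / 2)) * dist π ρ ^ 2 + b + a ^ 2 / 2 * dist π ρ ^ 2
      + a * b * dist π ρ + b ^ 2 / 2 : ℝ) : EReal)

/-- The test function `f‡ = -(a/2) d²(γ,·) - b d_T(·,π) + c`. -/
def fDdag {E : Type*} [MetricSpace E] (S : ℝ → E → E) (κ : ℝ)
    (a b c : ℝ) (π γ : E) (μ : E) : ℝ :=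
  -(a / 2) * dist γ μ ^ 2 - b * tataru S κ μ π + c

/-- The lower bound `g‡` for the Hamiltonian on `f‡`. -/
def gDdag {E : Type*} [MetricSpace E] (En : E → EReal) (κ : ℝ)
    (a b : ℝ) (γ : E) (μ : E) : EReal :=
  ((a : ℝ) : EReal) * (En μ - En γ) +
    ((a * (κ / 2) * dist γ μ ^ 2 - b + a ^ 2 / 2 * dist γ μ ^ 2
      - a * b * dist γ μ - b ^ 2 / 2 : ℝ) : EReal)

/-- Viscosity subsolution of `f - λ H† f = h†` (Definition 2.7). -/
def IsViscositySubsolution {E : Type*} [MetricSpace E]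
    (En : E → EReal) (κ : ℝ) (S : ℝ → E → E)
    (lam : ℝ) (hd : E → ℝ) (u : E → ℝ) : Prop :=
  (∃ M : ℝ, ∀ π : E, |u π| ≤ M) ∧ UpperSemicontinuous u ∧
  ∀ a b c : ℝ, 0 < a → 0 < b → ∀ μ ρ : E, En ρ < ⊤ →
    ∃ πs : ℕ → E,
      Filter.Tendsto (fun n => u (πs n) - fDag S κ a b c μ ρ (πs n)) Filter.atTop
        (𝓝 (⨆ π : E, (u π - fDag S κ a b c μ ρ π))) ∧
      Filter.limsup
        (fun n => ((u (πs n) : ℝ) : EReal) - ((lam : ℝ) : EReal) * gDag En κ a b ρ (πs n)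
          - ((hd (πs n) : ℝ) : EReal)) Filter.atTop ≤ 0

/-- Viscosity supersolution of `f - λ H‡ f = h‡` (Definition 2.7). -/
def IsViscositySupersolution {E : Type*} [MetricSpace E]
    (En : E → EReal) (κ : ℝ) (S : ℝ → E → E)
    (lam : ℝ) (hd : E → ℝ) (v : E → ℝ) : Prop :=
  (∃ M : ℝ, ∀ π : E, |v π| ≤ M) ∧ LowerSemicontinuous v ∧
  ∀ a b c : ℝ, 0 < a → 0 < b → ∀ π γ : E, En γ < ⊤ →
    ∃ μs : ℕ → E,
      Filter.Tendsto (fun n => v (μs n) - fDdag S κ a b c π γ (μs n)) Filter.atTop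
        (𝓝 (⨅ μ : E, (v μ - fDdag S κ a b c π γ μ))) ∧
      (0 : EReal) ≤ Filter.liminf
        (fun n => ((v (μs n) : ℝ) : EReal) - ((lam : ℝ) : EReal) * gDdag En κ a b γ (μs n)
          - ((hd (μs n) : ℝ) : EReal)) Filter.atTop

end

theorem sub_le_of_frequently_slope_lt {φ : ℝ → ℝ} {p q c : ℝ} (hpq : p ≤ q)
    (hφ : ContinuousOn φ (Set.Icc p q))
    (h : ∀ t ∈ Set.Ico p q, ∀ r, c < r → ∃ᶠ z in 𝓝[>] t, slope φ t z < r) :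
    φ q ≤ φ p + c * (q - p) := by
  refine image_le_of_liminf_slope_right_le_deriv_boundary (B := fun x => φ p + c * (x - p))
    (B' := fun _ => c) hφ (by simp) (by fun_prop) ?_ h (Set.right_mem_Icc.2 hpq)
  intro x _
  simpa using ((((hasDerivAt_id x).sub_const p).const_mul c).const_add (φ p)).hasDerivWithinAt

/-- The pointwise form of the evolution variational inequality in terms of real slopes. -/
theorem IsEVISolution.eventually_slope_lt {E : Type*} [MetricSpace E] {En : E → EReal}
    (hbot : ∀ π : E, En π ≠ ⊥) {κ : ℝ} {γ : ℝ → E} (hγ : IsEVISolution En κ γ)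
    {z : E} (hz : En z < ⊤) {t : ℝ} (ht : 0 ≤ t) (hγt : En (γ t) < ⊤) {r : ℝ}
    (hr : 2 * ((En z).toReal - (En (γ t)).toReal) - κ * dist (γ t) z ^ 2 < r) :
    ∀ᶠ y in 𝓝[>] t, slope (fun s => dist (γ s) z ^ 2) t y < r := by
  have h := hγ.2.2 z hz t ht
  lift En z to ℝ using ⟨hz.ne, hbot z⟩ with a
  lift En (γ t) to ℝ using ⟨hγt.ne, hbot _⟩ with b
  simp only [EReal.toReal_coe] at hr
  have h2 : diniUR (fun s => dist (γ s) z ^ 2) t < (r : EReal) := by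
    by_contra hcon
    push Not at hcon
    have h5 : (1 / 2 : EReal) = ((1 / 2 : ℝ) : EReal) := by
      rw [EReal.coe_div]; norm_cast
    have h3 : (1 / 2 : EReal) * (r : EReal) ≤ (1/2 : EReal) * diniUR (fun s => dist (γ s) z ^ 2) t :=
      mul_le_mul_of_nonneg_left hcon (by rw [h5]; exact_mod_cast (by norm_num : (0 : ℝ) ≤ 1 / 2))
    have h4 := h3.trans h
    rw [h5] at h4
    norm_cast at h4
    nlinarith
  have h6 := eventually_lt_of_limsup_lt h2
  have h7 : Tendsto (fun y => y - t) (𝓝[>] t) (𝓝[>] 0) := by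
    refine tendsto_nhdsWithin_iff.2 ⟨?_, ?_⟩
    · have : Tendsto (fun y : ℝ => y - t) (𝓝 t) (𝓝 (t - t)) := by
        exact (continuous_id.sub continuous_const).tendsto t
      rw [sub_self] at this
      exact this.mono_left nhdsWithin_le_nhds
    · filter_upwards [self_mem_nhdsWithin] with y hy
      simpa using hy
  filter_upwards [h7.eventually h6] with y hy
  rw [slope_def_field]
  simpa using hy

section Flow

variable {E : Type*} [MetricSpace E] {En : E → EReal} {κ : ℝ} {S : ℝ → E → E}

theorem IsEVIFlow.continuousOn (hflow : IsEVIFlow En κ S) (x : E) :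
    ContinuousOn (fun t => S t x) (Set.Ici 0) := (hflow.evi x).1

theorem IsEVIFlow.energy_lt_top (hflow : IsEVIFlow En κ S) (x : E) {t : ℝ} (ht : 0 < t) :
    En (S t x) < ⊤ := (hflow.evi x).2.1 t ht

theorem IsEVIFlow.energy_lt_top_of_le (hflow : IsEVIFlow En κ S) {x : E} (hx : En x < ⊤)
    {t : ℝ} (ht : 0 ≤ t) : En (S t x) < ⊤ := by
  rcases ht.eq_or_lt with rfl | ht
  · rwa [hflow.id0]
  · exact hflow.energy_lt_top x ht

/-- The energy decreases along the flow. -/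
theorem IsEVIFlow.energy_le (hflow : IsEVIFlow En κ S) (hbot : ∀ π : E, En π ≠ ⊥)
    (hlsc : LowerSemicontinuous En) (x : E) {t : ℝ} (ht : 0 ≤ t) : En (S t x) ≤ En x := by
  rcases eq_or_ne (En x) ⊤ with hx | hx
  · simp [hx]
  have hx : En x < ⊤ := lt_top_iff_ne_top.2 hx
  by_contra hcon
  push Not at hcon
  set A := {r : ℝ | r ∈ Set.Icc 0 t ∧ En (S r x) ≤ En x} with hA
  have hAc : IsClosed A := by
    exact ((hflow.continuousOn x).mono Set.Icc_subset_Ici_self).preimage_isClosed_of_isClosed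
      isClosed_Icc (hlsc.isClosed_preimage (En x))
  have h0 : (0 : ℝ) ∈ A := ⟨⟨le_rfl, ht⟩, by rw [hflow.id0]⟩
  have hAb : BddAbove A := ⟨t, fun r hr => hr.1.2⟩
  set p := sSup A
  have hp : p ∈ A := hAc.csSup_mem ⟨0, h0⟩ hAb
  have hpt : p < t := lt_of_le_of_ne hp.1.2 (by rintro h; rw [h] at hp; exact absurd hp.2 (not_le.2 hcon))
  have hEp : En (S p x) < ⊤ := hp.2.trans_lt hx
  have hlt : ∀ r ∈ Set.Icc p t, En (S p x) ≤ En (S r x) := by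
    intro r hr
    rcases hr.1.eq_or_lt with rfl | h
    · exact le_rfl
    · by_contra hc
      push Not at hc
      exact absurd (le_csSup hAb (show r ∈ A from ⟨⟨hp.1.1.trans hr.1, hr.2⟩, hc.le.trans hp.2⟩))
        (not_le.2 h)
  have hcont : ContinuousOn (fun s => dist (S s x) (S p x) ^ 2) (Set.Icc p t) := by
    have := (hflow.continuousOn x).mono (show Set.Icc p t ⊆ Set.Ici 0 from
      fun r hr => hp.1.1.trans hr.1)
    fun_prop
  have := le_gronwallBound_of_liminf_deriv_right_le (δ := 0) (K := -κ) (ε := 0)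
    (f' := fun r => 2 * ((En (S p x)).toReal - (En (S r x)).toReal) - κ * dist (S r x) (S p x) ^ 2)
    hcont ?_ (by simp) ?_ t ⟨hpt.le, le_rfl⟩
  · rw [gronwallBound_ε0_δ0] at this
    have h2 : dist (S t x) (S p x) = 0 := by nlinarith [sq_nonneg (dist (S t x) (S p x))]
    rw [dist_eq_zero.1 h2] at hcon
    exact absurd hp.2 (not_le.2 hcon)
  · intro r hr q hq
    have hr0 : 0 ≤ r := hp.1.1.trans hr.1
    have := ((hflow.evi x).eventually_slope_lt hbot hEp hr0
      (hflow.energy_lt_top_of_le hx hr0) hq).frequently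
    simpa [slope_def_field, div_eq_inv_mul] using this
  · intro r hr
    have h1 := hlt r ⟨hr.1, hr.2.le⟩
    have h2 := EReal.toReal_le_toReal h1 (hbot _)
      (hflow.energy_lt_top_of_le hx (hp.1.1.trans hr.1)).ne
    linarith

end Flow

section Flow

variable {E : Type*} [MetricSpace E] {En : E → EReal} {κ : ℝ} {S : ℝ → E → E}

theorem IsEVIFlow.tendsto_zero (hflow : IsEVIFlow En κ S) (x : E) :
    Tendsto (fun t => S t x) (𝓝[≥] 0) (𝓝 x) := by
  have := hflow.continuousOn x 0 Set.self_mem_Ici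
  simpa [ContinuousWithinAt, hflow.id0] using this

/-- The right derivative of the squared distance between two flow lines. -/
theorem IsEVIFlow.eventually_dist_sq_lt (hflow : IsEVIFlow En κ S) (hbot : ∀ π : E, En π ≠ ⊥)
    (hlsc : LowerSemicontinuous En) {x y : E} (hx : En x < ⊤) (hy : En y < ⊤) {c : ℝ}
    (hc : -2 * κ * dist x y ^ 2 < c) :
    ∀ᶠ h in 𝓝[>] (0 : ℝ), dist (S h x) (S h y) ^ 2 < dist x y ^ 2 + c * h := by
  set η := (c + 2 * κ * dist x y ^ 2) / 8 with hη
  have hηpos : 0 < η := by rw [hη]; linarith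
  have h1 : ∀ᶠ h in 𝓝[>] (0 : ℝ), slope (fun s => dist (S s x) y ^ 2) 0 h <
      2 * ((En y).toReal - (En x).toReal) - κ * dist x y ^ 2 + η := by
    have := (hflow.evi x).eventually_slope_lt hbot hy le_rfl (by rwa [hflow.id0])
      (r := 2 * ((En y).toReal - (En x).toReal) - κ * dist x y ^ 2 + η)
      (by rw [hflow.id0]; linarith)
    exact this
  have h2 : ∀ᶠ r in 𝓝[≥] (0 : ℝ), (En y).toReal - η < (En (S r y)).toReal := by
    have hlt : (((En y).toReal - η : ℝ) : EReal) < En y := by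
      conv_rhs => rw [← EReal.coe_toReal hy.ne (hbot y)]
      exact_mod_cast sub_lt_self _ hηpos
    filter_upwards [(hflow.tendsto_zero y).eventually (hlsc y _ hlt), self_mem_nhdsWithin]
      with r hr hr0
    rw [← EReal.coe_toReal (hflow.energy_lt_top_of_le hy hr0).ne (hbot _)] at hr
    exact_mod_cast hr
  have h3 : ∀ᶠ p in (𝓝[≥] (0 : ℝ)) ×ˢ (𝓝[≥] (0 : ℝ)),
      -κ * dist (S p.1 y) (S p.2 x) ^ 2 < -κ * dist x y ^ 2 + η := by
    have : Tendsto (fun p : ℝ × ℝ => -κ * dist (S p.1 y) (S p.2 x) ^ 2)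
        ((𝓝[≥] (0 : ℝ)) ×ˢ (𝓝[≥] (0 : ℝ))) (𝓝 (-κ * dist y x ^ 2)) :=
      ((((hflow.tendsto_zero y).comp tendsto_fst).dist
        ((hflow.tendsto_zero x).comp tendsto_snd)).pow 2).const_mul _
    refine this.eventually_lt_const ?_
    rw [dist_comm y x]; linarith
  obtain ⟨δ₁, hδ₁, h2⟩ := (mem_nhdsGE_iff_exists_Ico_subset).1 h2
  obtain ⟨P, hP, Q, hQ, h3⟩ := eventually_prod_iff.1 h3
  obtain ⟨δ₂, hδ₂, h3'⟩ := (mem_nhdsGE_iff_exists_Ico_subset).1 (hP.and hQ)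
  have hδ : (0 : ℝ) < min δ₁ δ₂ := lt_min hδ₁ hδ₂
  filter_upwards [h1, Ioo_mem_nhdsGT hδ] with h hh1 hh
  have hh0 : 0 < h := hh.1
  have hhδ₁ : h < δ₁ := hh.2.trans_le (min_le_left _ _)
  have hhδ₂ : h < δ₂ := hh.2.trans_le (min_le_right _ _)
  rw [slope_def_field, sub_zero, div_lt_iff₀ hh0, hflow.id0] at hh1
  have hxh := hflow.energy_lt_top_of_le hx hh0.le
  have hle := EReal.toReal_le_toReal (hflow.energy_le hbot hlsc x hh0.le) (hbot _) hx.ne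
  have hcont : ContinuousOn (fun s => dist (S s y) (S h x) ^ 2) (Set.Icc 0 h) := by
    have := (hflow.continuousOn y).mono (Set.Icc_subset_Ici_self : Set.Icc 0 h ⊆ Set.Ici 0)
    fun_prop
  have key := sub_le_of_frequently_slope_lt (φ := fun s => dist (S s y) (S h x) ^ 2)
    (c := 2 * ((En x).toReal - (En y).toReal + η) - κ * dist x y ^ 2 + η) hh0.le hcont ?_
  · simp only [hflow.id0] at key
    rw [dist_comm y, dist_comm (S h y)] at key
    have : 8 * η = c + 2 * κ * dist x y ^ 2 := by rw [hη]; ring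
    nlinarith
  · intro r hr q hq
    refine ((hflow.evi y).eventually_slope_lt hbot hxh hr.1
      (hflow.energy_lt_top_of_le hy hr.1) ?_).frequently
    have a1 := h2 (show r ∈ Set.Ico 0 δ₁ from ⟨hr.1, hr.2.trans hhδ₁⟩)
    have a2 := h3 (h3' ⟨hr.1, hr.2.trans hhδ₂⟩).1 (h3' ⟨hh0.le, hhδ₂⟩).2
    simp only [Set.mem_ofPred_eq] at a1 a2
    linarith

theorem IsEVIFlow.dist_sq_le_of_lt_top (hflow : IsEVIFlow En κ S) (hbot : ∀ π : E, En π ≠ ⊥)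
    (hlsc : LowerSemicontinuous En) {x y : E} (hx : En x < ⊤) (hy : En y < ⊤) {t : ℝ}
    (ht : 0 ≤ t) : dist (S t x) (S t y) ^ 2 ≤ dist x y ^ 2 * Real.exp (-2 * κ * t) := by
  have hcont : ContinuousOn (fun s => dist (S s x) (S s y) ^ 2) (Set.Icc 0 t) := by
    have h1 := (hflow.continuousOn x).mono (Set.Icc_subset_Ici_self : Set.Icc 0 t ⊆ Set.Ici 0)
    have h2 := (hflow.continuousOn y).mono (Set.Icc_subset_Ici_self : Set.Icc 0 t ⊆ Set.Ici 0)
    fun_prop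
  have := le_gronwallBound_of_liminf_deriv_right_le (δ := dist x y ^ 2) (K := -2 * κ) (ε := 0)
    (f' := fun r => -2 * κ * dist (S r x) (S r y) ^ 2) hcont ?_ (by simp [hflow.id0])
    (by simp) t ⟨ht, le_rfl⟩
  · simpa [gronwallBound_ε0] using this
  · intro r hr q hq
    have h1 := hflow.eventually_dist_sq_lt hbot hlsc (hflow.energy_lt_top_of_le hx hr.1)
      (hflow.energy_lt_top_of_le hy hr.1) hq
    have h7 : Tendsto (fun y => y - r) (𝓝[>] r) (𝓝[>] 0) := by
      refine tendsto_nhdsWithin_iff.2 ⟨?_, ?_⟩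
      · have : Tendsto (fun y : ℝ => y - r) (𝓝 r) (𝓝 (r - r)) :=
          (continuous_id.sub continuous_const).tendsto r
        rw [sub_self] at this
        exact this.mono_left nhdsWithin_le_nhds
      · filter_upwards [self_mem_nhdsWithin] with y hy
        simpa using hy
    refine Eventually.frequently ?_
    filter_upwards [h7.eventually h1, self_mem_nhdsWithin] with z hz hzr
    have hzr : r < z := hzr
    rw [← hflow.semigroup x (z - r) r (by linarith) hr.1,
      ← hflow.semigroup y (z - r) r (by linarith) hr.1, add_sub_cancel] at hz
    rw [inv_mul_lt_iff₀ (by linarith)]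
    linarith

/-- The flow is a `κ`-contraction. -/
theorem IsEVIFlow.dist_le (hflow : IsEVIFlow En κ S) (hbot : ∀ π : E, En π ≠ ⊥)
    (hlsc : LowerSemicontinuous En) (x y : E) {t : ℝ} (ht : 0 ≤ t) :
    dist (S t x) (S t y) ≤ Real.exp (-κ * t) * dist x y := by
  have hx := (hflow.tendsto_zero x).mono_left (nhdsWithin_mono 0 Set.Ioi_subset_Ici_self)
  have hy := (hflow.tendsto_zero y).mono_left (nhdsWithin_mono 0 Set.Ioi_subset_Ici_self)
  have hx' := ((hflow.cont t ht).tendsto x).comp hx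
  have hy' := ((hflow.cont t ht).tendsto y).comp hy
  have h : dist (S t x) (S t y) ^ 2 ≤ dist x y ^ 2 * Real.exp (-2 * κ * t) := by
    refine le_of_tendsto_of_tendsto ((hx'.dist hy').pow 2) (((hx.dist hy).pow 2).mul_const _) ?_
    filter_upwards [self_mem_nhdsWithin] with s hs
    exact hflow.dist_sq_le_of_lt_top hbot hlsc (hflow.energy_lt_top x hs)
      (hflow.energy_lt_top y hs) ht
  refine le_of_sq_le_sq ?_ (by positivity)
  rw [mul_pow, ← Real.exp_nat_mul]
  calc _ ≤ _ := h
    _ = _ := by rw [mul_comm]; congr 2; push_cast; ring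

/-- Energy dissipation along the flow is controlled from below by the squared slope. -/
theorem IsEVIFlow.frequently_energy_le (hflow : IsEVIFlow En κ S) (hbot : ∀ π : E, En π ≠ ⊥)
    (hlsc : LowerSemicontinuous En) {x : E} (hx : En x < ⊤) {L : ℝ} (hL : 0 ≤ L)
    (hLx : L = 0 ∨ ENNReal.ofReal L < localSlope En x) :
    ∃ᶠ s in 𝓝[>] (0 : ℝ), (En (S s x)).toReal ≤ (En x).toReal - L ^ 2 / 4 * s := by
  rcases hL.eq_or_lt with rfl | hL
  · refine Eventually.frequently ?_
    filter_upwards [self_mem_nhdsWithin] with s hs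
    have := EReal.toReal_le_toReal (hflow.energy_le hbot hlsc x (le_of_lt hs)) (hbot _) hx.ne
    simpa using this
  have hLx := hLx.resolve_left hL.ne'
  rw [localSlope, if_neg hx.ne] at hLx
  have hfr := frequently_lt_of_lt_limsup (by isBoundedDefault) hLx
  intro hev
  obtain ⟨δ, hδ, hev⟩ := mem_nhdsGT_iff_exists_Ioo_subset.1 hev
  have hδ : 0 < δ := hδ
  have hclose : ∀ᶠ y in 𝓝[≠] x, dist y x < L * δ ∧ |κ| * dist y x < L / 4 := by
    refine Filter.Eventually.filter_mono nhdsWithin_le_nhds ?_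
    have hd : Tendsto (fun y => dist y x) (𝓝 x) (𝓝 0) := tendsto_iff_dist_tendsto_zero.1 tendsto_id
    have hd2 := hd.const_mul |κ|
    rw [mul_zero] at hd2
    exact (hd.eventually_lt_const (by positivity)).and (hd2.eventually_lt_const (by positivity))
  obtain ⟨y, hy1, ⟨hy2, hy3⟩, hyne⟩ :=
    (hfr.and_eventually (hclose.and self_mem_nhdsWithin)).exists
  rw [dist_comm] at hy2 hy3
  have hd : 0 < dist x y := dist_pos.2 (Ne.symm hyne)
  have hy1 := (ENNReal.ofReal_lt_ofReal_iff_of_nonneg hL.le).1 hy1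
  rw [lt_div_iff₀ hd] at hy1
  have hyt : En y < ⊤ := by
    refine lt_top_iff_ne_top.2 fun h => ?_
    rw [h, EReal.sub_top] at hy1
    simp only [EReal.toReal_bot] at hy1
    nlinarith
  rw [EReal.toReal_sub hx.ne (hbot _) hyt.ne (hbot _)] at hy1
  set d := dist x y with hdd
  set t := d / L with ht
  have ht0 : 0 < t := by positivity
  have hLt : L * t = d := by rw [ht]; field_simp
  have htδ : t < δ := by nlinarith
  have hno : ∀ s ∈ Set.Ico 0 t, (En y).toReal + 3 / 4 * L * d ≤ (En (S s x)).toReal := by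
    intro s hs
    rcases hs.1.eq_or_lt with rfl | hs0
    · rw [hflow.id0]; nlinarith
    · have := hev ⟨hs0, hs.2.trans htδ⟩
      simp only [Set.mem_ofPred_eq, not_le] at this
      nlinarith [mul_pos (mul_pos hL hL) (sub_pos.2 hs.2)]
  have hcont : ContinuousOn (fun s => dist (S s x) y ^ 2) (Set.Icc 0 t) := by
    have h1 := (hflow.continuousOn x).mono (Set.Icc_subset_Ici_self : Set.Icc 0 t ⊆ Set.Ici 0)
    fun_prop
  have key := image_le_of_liminf_slope_right_lt_deriv_boundary'
    (f' := fun s => 2 * ((En y).toReal - (En (S s x)).toReal) - κ * dist (S s x) y ^ 2)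
    (B := fun s => d ^ 2 - 5 / 4 * L * d * s) (B' := fun _ => - (5 / 4 * L * d)) hcont ?_
    (by simp [hflow.id0, hdd]) (by fun_prop) ?_ ?_ (Set.right_mem_Icc.2 ht0.le)
  · nlinarith [sq_nonneg (dist (S t x) y)]
  · intro s hs r hr
    exact ((hflow.evi x).eventually_slope_lt hbot hyt hs.1
      (hflow.energy_lt_top_of_le hx hs.1) hr).frequently
  · intro s _
    simpa using (((hasDerivAt_id s).const_mul (5 / 4 * L * d)).const_sub (d ^ 2)).hasDerivWithinAt
  · intro s hs heq
    have h1 := hno s hs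
    have h2 : dist (S s x) y ^ 2 ≤ d ^ 2 := by
      have : 0 ≤ 5 / 4 * L * d * s := by have := hs.1; positivity
      linarith
    have h3 : -κ * dist (S s x) y ^ 2 ≤ |κ| * d ^ 2 :=
      mul_le_mul (neg_le_abs κ) h2 (by positivity) (abs_nonneg _)
    have h4 : |κ| * d * d < L / 4 * d := mul_lt_mul_of_pos_right hy3 hd
    nlinarith

/-- The energy is bounded below by a negative multiple of the squared distance. -/
theorem IsEVIFlow.exists_energy_ge (hflow : IsEVIFlow En κ S) (hbot : ∀ π : E, En π ≠ ⊥)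
    (hlsc : LowerSemicontinuous En) {x₀ : E} (hx₀ : En x₀ < ⊤) :
    ∃ C K : ℝ, 0 ≤ C ∧ 0 ≤ K ∧
      ∀ y, En y < ⊤ → -C - K * dist y x₀ ^ 2 ≤ (En y).toReal := by
  have hc : ContinuousOn (fun t => S t x₀) (Set.Icc 0 1) :=
    (hflow.continuousOn x₀).mono Set.Icc_subset_Ici_self
  have hK := isCompact_Icc.image_of_continuousOn hc
  obtain ⟨z, hz, hmin⟩ := (hlsc.lowerSemicontinuousOn _).exists_isMinOn
    (s := (fun t => S t x₀) '' Set.Icc 0 1) ⟨_, Set.mem_image_of_mem _ (by simp : (0:ℝ) ∈ Set.Icc 0 1)⟩ hK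
  obtain ⟨R, hR⟩ := hK.isBounded.subset_closedBall x₀
  have hR0 : 0 ≤ R := by
    have := hR hz
    exact dist_nonneg.trans this
  refine ⟨|(En z).toReal| + 1 / 2 + |κ| * R ^ 2, 1 / 2 + |κ|, by positivity, by positivity, ?_⟩
  intro y hy
  by_contra hcon
  push Not at hcon
  have hcont : ContinuousOn (fun s => dist (S s x₀) y ^ 2) (Set.Icc 0 1) := by fun_prop
  have key := sub_le_of_frequently_slope_lt (φ := fun s => dist (S s x₀) y ^ 2)
    (c := -(dist x₀ y ^ 2 + 1)) zero_le_one hcont ?_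
  · simp only [hflow.id0] at key
    nlinarith [sq_nonneg (dist (S 1 x₀) y)]
  · intro t ht r hr
    refine ((hflow.evi x₀).eventually_slope_lt hbot hy ht.1
      (hflow.energy_lt_top_of_le hx₀ ht.1) (lt_of_le_of_lt ?_ hr)).frequently
    have hmem : S t x₀ ∈ (fun t => S t x₀) '' Set.Icc 0 1 := Set.mem_image_of_mem _ ⟨ht.1, ht.2.le⟩
    have h1 := EReal.toReal_le_toReal (hmin hmem) (hbot _) (hflow.energy_lt_top_of_le hx₀ ht.1).ne
    have h2 : dist (S t x₀) x₀ ≤ R := hR hmem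
    have h3 : dist (S t x₀) y ≤ R + dist y x₀ := by
      linarith [dist_triangle_right (S t x₀) y x₀]
    have h4 : dist (S t x₀) y ^ 2 ≤ 2 * R ^ 2 + 2 * dist y x₀ ^ 2 := by
      nlinarith [sq_nonneg (R - dist y x₀), dist_nonneg (x := S t x₀) (y := y)]
    have h5 : -κ * dist (S t x₀) y ^ 2 ≤ |κ| * (2 * R ^ 2 + 2 * dist y x₀ ^ 2) :=
      mul_le_mul (neg_le_abs κ) h4 (by positivity) (abs_nonneg _)
    rw [dist_comm x₀ y]
    have := neg_abs_le (En z).toReal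
    nlinarith

end Flow

section Tataru

variable {E : Type*} [MetricSpace E] {En : E → EReal} {κ : ℝ} {S : ℝ → E → E}

theorem tataru_bddBelow (S : ℝ → E → E) (κ : ℝ) (π ρ : E) : BddBelow
    {x : ℝ | ∃ t : ℝ, 0 ≤ t ∧ x = t + Real.exp (min κ 0 * t) * dist π (S t ρ)} := by
  refine ⟨0, ?_⟩
  rintro _ ⟨t, ht, rfl⟩
  positivity

theorem tataru_nonneg (S : ℝ → E → E) (κ : ℝ) (π ρ : E) : 0 ≤ tataru S κ π ρ := by
  refine Real.sInf_nonneg ?_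
  rintro _ ⟨t, ht, rfl⟩
  positivity

theorem tataru_le (S : ℝ → E → E) (κ : ℝ) (π ρ : E) {t : ℝ} (ht : 0 ≤ t) :
    tataru S κ π ρ ≤ t + Real.exp (min κ 0 * t) * dist π (S t ρ) :=
  csInf_le (tataru_bddBelow S κ π ρ) ⟨t, ht, rfl⟩

theorem exists_lt_of_tataru_lt {π ρ : E} {r : ℝ} (h : tataru S κ π ρ < r) :
    ∃ t, 0 ≤ t ∧ t + Real.exp (min κ 0 * t) * dist π (S t ρ) < r := by
  obtain ⟨_, ⟨t, ht, rfl⟩, h⟩ := exists_lt_of_csInf_lt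
    (by exact ⟨_, 0, le_rfl, rfl⟩) h
  exact ⟨t, ht, h⟩

theorem IsEVIFlow.tataru_le_dist (hflow : IsEVIFlow En κ S) (π ρ : E) :
    tataru S κ π ρ ≤ dist π ρ := by
  simpa [hflow.id0] using tataru_le S κ π ρ le_rfl

theorem IsEVIFlow.tataru_self (hflow : IsEVIFlow En κ S) (π : E) : tataru S κ π π = 0 :=
  le_antisymm (by simpa using hflow.tataru_le_dist π π) (tataru_nonneg S κ π π)

theorem tataru_flow_le (S : ℝ → E → E) (κ : ℝ) (ρ : E) {t : ℝ} (ht : 0 ≤ t) :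
    tataru S κ (S t ρ) ρ ≤ t := by
  simpa using tataru_le S κ (S t ρ) ρ ht

theorem tataru_le_dist_add (S : ℝ → E → E) (κ : ℝ) (π π' ρ : E) :
    tataru S κ π ρ ≤ dist π π' + tataru S κ π' ρ := by
  refine le_of_forall_pos_lt_add fun η hη => ?_
  obtain ⟨t, ht, h⟩ := exists_lt_of_tataru_lt (lt_add_of_pos_right (tataru S κ π' ρ) hη)
  have h1 := tataru_le S κ π ρ ht
  have h2 := dist_triangle π π' (S t ρ)
  have h3 : Real.exp (min κ 0 * t) ≤ 1 :=
    Real.exp_le_one_iff.2 (mul_nonpos_of_nonpos_of_nonneg (min_le_right _ _) ht)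
  have h4 : 0 ≤ Real.exp (min κ 0 * t) := by positivity
  nlinarith [mul_le_mul_of_nonneg_left h2 h4,
    mul_le_mul_of_nonneg_right h3 (dist_nonneg (x := π) (y := π'))]

theorem continuous_tataru (S : ℝ → E → E) (κ : ℝ) (ρ : E) :
    Continuous fun π => tataru S κ π ρ := by
  refine (LipschitzWith.of_le_add fun x y => ?_ : LipschitzWith 1 _).continuous
  linarith [tataru_le_dist_add S κ x y ρ]

theorem IsEVIFlow.tataru_triangle (hflow : IsEVIFlow En κ S) (hbot : ∀ π : E, En π ≠ ⊥)
    (hlsc : LowerSemicontinuous En) (x y z : E) :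
    tataru S κ x z ≤ tataru S κ x y + tataru S κ y z := by
  refine le_of_forall_pos_lt_add fun η hη => ?_
  obtain ⟨t, ht, h⟩ := exists_lt_of_tataru_lt (lt_add_of_pos_right (tataru S κ x y) (half_pos hη))
  obtain ⟨s, hs, h'⟩ := exists_lt_of_tataru_lt (lt_add_of_pos_right (tataru S κ y z) (half_pos hη))
  have h1 := tataru_le S κ x z (add_nonneg hs ht)
  rw [hflow.semigroup z t s ht hs] at h1
  have h2 := dist_triangle x (S t y) (S t (S s z))
  have h3 := hflow.dist_le hbot hlsc y (S s z) ht
  have e1 : Real.exp (min κ 0 * (s + t)) ≤ Real.exp (min κ 0 * t) := by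
    refine Real.exp_le_exp.2 ?_
    nlinarith [min_le_right κ 0]
  have e2 : Real.exp (min κ 0 * (s + t)) * Real.exp (-κ * t) ≤ Real.exp (min κ 0 * s) := by
    rw [← Real.exp_add]
    refine Real.exp_le_exp.2 ?_
    nlinarith [min_le_left κ 0]
  have a1 := mul_le_mul_of_nonneg_right e1 (dist_nonneg (x := x) (y := S t y))
  have a2 := mul_le_mul_of_nonneg_right e2 (dist_nonneg (x := y) (y := S s z))
  have a3 := mul_le_mul_of_nonneg_left (h2.trans (add_le_add_right h3 _))
    (Real.exp_pos (min κ 0 * (s + t))).le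
  nlinarith

theorem IsEVIFlow.tendsto_of_tataru (hflow : IsEVIFlow En κ S) {x : ℕ → E} {y : E}
    (h : Tendsto (fun n => tataru S κ (x n) y) atTop (𝓝 0)) : Tendsto x atTop (𝓝 y) := by
  rw [Metric.tendsto_nhds]
  intro η hη
  have h1 := hflow.tendsto_zero y
  rw [Metric.tendsto_nhds] at h1
  obtain ⟨δ, hδ, h1⟩ := mem_nhdsGE_iff_exists_Ico_subset.1 (h1 (η / 2) (half_pos hη))
  have hδ : 0 < δ := hδ
  set A := Real.exp (min κ 0 * δ) with hA
  have hA0 : 0 < A := Real.exp_pos _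
  filter_upwards [h.eventually_lt_const (show 0 < min δ (A * (η / 2)) by positivity)] with n hn
  obtain ⟨t, ht, hlt⟩ := exists_lt_of_tataru_lt hn
  have hlt1 := hlt.trans_le (min_le_left _ _)
  have hlt2 := hlt.trans_le (min_le_right _ _)
  have htδ : t < δ := by
    have : 0 ≤ Real.exp (min κ 0 * t) * dist (x n) (S t y) := by positivity
    linarith
  have hle : A ≤ Real.exp (min κ 0 * t) := by
    rw [hA]
    refine Real.exp_le_exp.2 ?_
    nlinarith [min_le_right κ 0]
  have h2 : A * dist (x n) (S t y) < A * (η / 2) := by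
    nlinarith [mul_le_mul_of_nonneg_right hle (dist_nonneg (x := x n) (y := S t y))]
  have h3 := lt_of_mul_lt_mul_left h2 hA0.le
  have h4 : dist (S t y) y < η / 2 := h1 ⟨ht, htδ⟩
  linarith [dist_triangle (x n) (S t y) y]

/-- Sequences with summable consecutive Tataru distances converge. -/
theorem IsEVIFlow.exists_tendsto_of_tataru [CompleteSpace E] (hflow : IsEVIFlow En κ S)
    (hbot : ∀ π : E, En π ≠ ⊥) (hlsc : LowerSemicontinuous En) {x : ℕ → E} {r : ℕ → ℝ}
    (hr : Summable r) (h : ∀ n, tataru S κ (x (n + 1)) (x n) < r n) :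
    ∃ y, Tendsto x atTop (𝓝 y) := by
  choose t ht hlt using fun n => exists_lt_of_tataru_lt (h n)
  have hr0 : ∀ n, 0 ≤ r n := fun n => (tataru_nonneg S κ _ _).trans (h n).le
  have htr : ∀ n, t n ≤ r n := fun n => by
    have : 0 ≤ Real.exp (min κ 0 * t n) * dist (x (n + 1)) (S (t n) (x n)) := by positivity
    linarith [hlt n]
  have hts : Summable t := Summable.of_nonneg_of_le ht htr hr
  set s : ℕ → ℝ := fun m => ∑ k ∈ Finset.range m, t k with hs
  have hsmono : Monotone s := monotone_nat_of_le_succ fun n => by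
    simp only [hs, Finset.sum_range_succ]
    linarith [ht n]
  have hslim : Tendsto s atTop (𝓝 (∑' k, t k)) := hts.hasSum.tendsto_sum_nat
  set T := ∑' k, t k
  have hsT : ∀ n, s n ≤ T := fun n => hsmono.ge_of_tendsto hslim n
  have hs0 : ∀ n, 0 ≤ s n := fun n => Finset.sum_nonneg fun k _ => ht k
  set q : ℕ → ℝ := fun m => ∑ k ∈ Finset.range m, r k with hq
  have hqlim : Tendsto q atTop (𝓝 (∑' k, r k)) := hr.hasSum.tendsto_sum_nat
  set R := ∑' k, r k
  have hqmono : Monotone q := monotone_nat_of_le_succ fun n => by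
    simp only [hq, Finset.sum_range_succ]
    linarith [hr0 n]
  have hqR : ∀ n, q n ≤ R := fun n => hqmono.ge_of_tendsto hqlim n
  have hstep : ∀ n, dist (x (n + 1)) (S (t n) (x n)) ≤ Real.exp (|κ| * t n) * r n := by
    intro n
    have h1 : Real.exp (min κ 0 * t n) * dist (x (n + 1)) (S (t n) (x n)) ≤ r n := by
      linarith [hlt n, ht n]
    have h2 := mul_le_mul_of_nonneg_left h1 (Real.exp_pos (|κ| * t n)).le
    rw [← mul_assoc, ← Real.exp_add] at h2
    have h3 : 1 ≤ Real.exp (|κ| * t n + min κ 0 * t n) := by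
      refine Real.one_le_exp ?_
      rw [← add_mul]
      refine mul_nonneg ?_ (ht n)
      rcases le_total κ 0 with h | h
      · rw [min_eq_left h]; linarith [neg_abs_le κ]
      · rw [min_eq_right h]; positivity
    exact (le_mul_of_one_le_left dist_nonneg h3).trans h2
  have hmain : ∀ n m, n ≤ m →
      dist (x m) (S (s m - s n) (x n)) ≤ Real.exp (|κ| * (s m - s n)) * (q m - q n) := by
    intro n m hnm
    induction m, hnm using Nat.le_induction with
    | base => simp [hflow.id0]
    | succ m hnm ih =>
      have e1 : s (m + 1) - s n = (s m - s n) + t m := by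
        simp only [hs, Finset.sum_range_succ]; ring
      have e2 : q (m + 1) - q n = (q m - q n) + r m := by
        simp only [hq, Finset.sum_range_succ]; ring
      have hsn : 0 ≤ s m - s n := sub_nonneg.2 (hsmono hnm)
      rw [e1, e2, hflow.semigroup (x n) (t m) (s m - s n) (ht m) hsn]
      have h1 := hflow.dist_le hbot hlsc (x m) (S (s m - s n) (x n)) (ht m)
      have h2 : Real.exp (-κ * t m) ≤ Real.exp (|κ| * t m) := by
        refine Real.exp_le_exp.2 ?_
        exact mul_le_mul_of_nonneg_right (neg_le_abs κ) (ht m)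
      have h3 := mul_le_mul h2 ih dist_nonneg (Real.exp_pos _).le
      have h4 : Real.exp (|κ| * t m) ≤ Real.exp (|κ| * (s m - s n + t m)) := by
        refine Real.exp_le_exp.2 ?_
        nlinarith [abs_nonneg κ]
      have h5 := mul_le_mul_of_nonneg_right h4 (hr0 m)
      have h6 : Real.exp (|κ| * t m) * (Real.exp (|κ| * (s m - s n)) * (q m - q n)) =
          Real.exp (|κ| * (s m - s n + t m)) * (q m - q n) := by
        rw [← mul_assoc, ← Real.exp_add]; congr 2; ring
      linarith [dist_triangle (x (m + 1)) (S (t m) (x m)) (S (t m) (S (s m - s n) (x n))),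
        hstep m]
  set A := Real.exp (|κ| * T) with hA
  have hA0 : 0 < A := Real.exp_pos _
  refine cauchySeq_tendsto_of_complete (Metric.cauchySeq_iff'.2 fun η hη => ?_)
  obtain ⟨n, hn⟩ := ((hqlim.const_sub R).const_mul A |>.eventually_lt_const
    (show A * (R - R) < η / 4 by simpa using hη)).exists
  have hz : Tendsto (fun m => S (s m - s n) (x n)) atTop (𝓝 (S (T - s n) (x n))) := by
    refine ((hflow.continuousOn (x n)) (T - s n) (sub_nonneg.2 (hsT n))).tendsto.comp
      (tendsto_nhdsWithin_iff.2 ⟨hslim.sub_const _, ?_⟩)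
    filter_upwards [eventually_ge_atTop n] with m hm
    exact sub_nonneg.2 (hsmono hm)
  rw [Metric.tendsto_nhds] at hz
  have hev : ∀ᶠ m in atTop, dist (x m) (S (T - s n) (x n)) < η / 2 := by
    filter_upwards [hz (η / 4) (by positivity), eventually_ge_atTop n] with m hm hnm
    have h1 := hmain n m hnm
    have h2 : Real.exp (|κ| * (s m - s n)) ≤ A := by
      rw [hA]
      refine Real.exp_le_exp.2 ?_
      exact mul_le_mul_of_nonneg_left (by linarith [hsT m, hs0 n]) (abs_nonneg κ)
    have h3 := mul_le_mul h2 (sub_le_sub_right (hqR m) (q n))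
      (sub_nonneg.2 (hqmono hnm)) hA0.le
    linarith [dist_triangle (x m) (S (s m - s n) (x n)) (S (T - s n) (x n))]
  obtain ⟨N, hN⟩ := eventually_atTop.1 hev
  refine ⟨N, fun m hm => ?_⟩
  linarith [dist_triangle_right (x m) (x N) (S (T - s n) (x n)), hN m hm, hN N le_rfl]

end Tataru

/-- Ekeland's variational principle for an asymmetric distance `D`, with domain `P`. -/
theorem exists_almost_maximizer {X : Type*} [TopologicalSpace X] {D : X → X → ℝ} {P : X → Prop}
    {f : X → ℝ} {B : ℝ} (hself : ∀ x, D x x = 0)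
    (htri : ∀ x y z, D x z ≤ D x y + D y z) (hcont : ∀ y, Continuous fun x => D x y)
    (hcomplete : ∀ (x : ℕ → X) (r : ℕ → ℝ), Summable r → (∀ n, D (x (n + 1)) (x n) < r n) →
      ∃ y, Tendsto x atTop (𝓝 y))
    (hnonneg : ∀ x y, 0 ≤ D x y)
    (hf : ∀ (x : ℕ → X) (y : X), (∀ n, P (x n)) → Monotone (fun n => f (x n)) →
      Tendsto x atTop (𝓝 y) → P y ∧ ∀ n, f (x n) ≤ f y)
    (hB : ∀ x, P x → f x ≤ B) {x₀ : X} (hx₀ : P x₀) {ε : ℝ} (hε : 0 < ε) :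
    ∃ x, P x ∧ f x₀ ≤ f x ∧ ∀ y, P y → f y ≤ f x + ε * D y x := by
  have hstep : ∀ (n : ℕ) (x : {x // P x}), ∃ x' : {x // P x},
      f x + ε * D x' x ≤ f x' ∧
      ∀ y, P y → f x + ε * D y x ≤ f y → f y ≤ f x' + (1 / 2) ^ n := by
    intro n x
    set A : Set ℝ := f '' {y | P y ∧ f x + ε * D y x ≤ f y} with hA
    have hne : A.Nonempty := ⟨f x, x, ⟨x.2, by simp [hself]⟩, rfl⟩
    have hbdd : BddAbove A := ⟨B, by rintro _ ⟨y, hy, rfl⟩; exact hB y hy.1⟩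
    obtain ⟨_, ⟨x', hx', rfl⟩, hlt⟩ := exists_lt_of_lt_csSup hne
      (sub_lt_self (sSup A) (show (0 : ℝ) < (1 / 2) ^ n by positivity))
    refine ⟨⟨x', hx'.1⟩, hx'.2, fun y hy hyx => ?_⟩
    have := le_csSup hbdd (Set.mem_image_of_mem f (show y ∈ {y | P y ∧ _ ≤ f y} from ⟨hy, hyx⟩))
    simp only
    linarith
  choose next hnext1 hnext2 using hstep
  let xs : ℕ → {x // P x} := fun n => Nat.rec (motive := fun _ => {x // P x}) ⟨x₀, hx₀⟩ (fun n x => next n x) n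
  have hxs : ∀ n, xs (n + 1) = next n (xs n) := fun n => rfl
  have h1 : ∀ n : ℕ, f (xs n) + ε * D (xs (n + 1)) (xs n) ≤ f (xs (n + 1)) := fun n => by
    rw [hxs]; exact hnext1 n (xs n)
  have h2 : ∀ (n : ℕ) (y : X), P y → f (xs n) + ε * D y (xs n) ≤ f y →
      f y ≤ f (xs (n + 1)) + (1 / 2) ^ n := fun n => by
    rw [hxs]; exact hnext2 n (xs n)
  have htrans : ∀ x y z, f x + ε * D y x ≤ f y → f y + ε * D z y ≤ f z →
      f x + ε * D z x ≤ f z := by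
    intro x y z hxy hyz
    have := mul_le_mul_of_nonneg_left (htri z y x) hε.le
    linarith
  have h3 : ∀ n m : ℕ, n ≤ m → f (xs n) + ε * D (xs m) (xs n) ≤ f (xs m) := by
    intro n m hnm
    induction m, hnm using Nat.le_induction with
    | base => simp [hself]
    | succ m _ ih => exact htrans _ _ _ ih (h1 m)
  have hmono : Monotone (fun n : ℕ => f (xs n)) := monotone_nat_of_le_succ fun n => by
    have := mul_nonneg hε.le (hnonneg (xs (n + 1)) (xs n))
    linarith [h1 n]
  obtain ⟨x, hx⟩ : ∃ x, Tendsto (fun n => (xs n : X)) atTop (𝓝 x) := by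
    obtain ⟨y, hy⟩ := hcomplete (fun n => xs (n + 1)) (fun n => 2 / ε * (1 / 2) ^ n)
      (summable_geometric_two.mul_left _) fun n => by
        have a1 := h2 n (xs (n + 2)) (xs (n + 2)).2 (h3 n (n + 2) (by omega))
        have a2 := h1 (n + 1)
        have a3 : (0 : ℝ) < (1 / 2) ^ n := by positivity
        rw [div_mul_eq_mul_div, lt_div_iff₀ hε]
        rw [show n + 1 + 1 = n + 2 from rfl] at *
        linarith
    exact ⟨y, (tendsto_add_atTop_iff_nat 1).1 hy⟩
  obtain ⟨hPx, hfx⟩ := hf (fun n => xs n) x (fun n => (xs n).2) hmono hx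
  have h4 : ∀ n : ℕ, f (xs n) + ε * D x (xs n) ≤ f x := by
    intro n
    refine le_of_tendsto ((((hcont (xs n)).tendsto x).comp hx).const_mul ε |>.const_add _) ?_
    filter_upwards [eventually_ge_atTop n] with m hm
    exact (h3 n m hm).trans (hfx m)
  refine ⟨x, hPx, hfx 0, fun y hy => ?_⟩
  by_contra hcon
  push Not at hcon
  have h5 : ∀ n : ℕ, f y ≤ f x + (1 / 2) ^ n := fun n =>
    (h2 n y hy (htrans _ _ _ (h4 n) hcon.le)).trans (by linarith [hfx (n + 1)])
  have h6 : f y ≤ f x + 0 := ge_of_tendsto'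
    ((tendsto_pow_atTop_nhds_zero_of_lt_one (by norm_num) (by norm_num)).const_add (f x)) h5
  have := mul_nonneg hε.le (hnonneg y x)
  linarith

theorem EReal.lt_top_and_mul_toReal_le {e : EReal} (he : e ≠ ⊥) {c X : ℝ} (hc : 0 < c)
    (h : ∀ m : ℝ, (m : EReal) < e → X + c * m ≤ 0) : e < ⊤ ∧ X + c * e.toReal ≤ 0 := by
  have hlt : e < ⊤ := by
    refine lt_top_iff_ne_top.2 fun htop => ?_
    have := h ((1 - X) / c) (by rw [htop]; exact EReal.coe_lt_top _)
    rw [mul_div_cancel₀ _ hc.ne'] at this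
    linarith
  refine ⟨hlt, ?_⟩
  refine le_of_forall_pos_le_add fun η hη => ?_
  have hlt' : ((e.toReal - η / c : ℝ) : EReal) < e := by
    conv_rhs => rw [← EReal.coe_toReal hlt.ne he]
    exact_mod_cast sub_lt_self _ (by positivity)
  have := h _ hlt'
  rw [mul_sub, mul_div_cancel₀ _ hc.ne'] at this
  linarith

section Flow

variable {E : Type*} [MetricSpace E] {En : E → EReal} {κ : ℝ} {S : ℝ → E → E}

/-- A maximizing sequence of a function with a strict Tataru-penalized maximum converges. -/
theorem IsEVIFlow.tendsto_of_penalized_max (hflow : IsEVIFlow En κ S) {w : E → ℝ} {a ε s : ℝ}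
    (hε : 0 < ε) {ρ π₀ : E}
    (hmax : ∀ π, w π - a / 2 * dist π ρ ^ 2 ≤
      w π₀ - a / 2 * dist π₀ ρ ^ 2 + ε * tataru S κ π π₀)
    (hs : w π₀ - a / 2 * dist π₀ ρ ^ 2 ≤ s) {πs : ℕ → E}
    (hlim : Tendsto (fun n => w (πs n) - fDag S κ a (2 * ε) 0 π₀ ρ (πs n)) atTop (𝓝 s)) :
    Tendsto πs atTop (𝓝 π₀) ∧ Tendsto (fun n => w (πs n)) atTop (𝓝 (w π₀)) := by
  set s₀ := w π₀ - a / 2 * dist π₀ ρ ^ 2 with hs₀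
  have h1 : ∀ n, ε * tataru S κ (πs n) π₀ ≤ s₀ - (w (πs n) - fDag S κ a (2 * ε) 0 π₀ ρ (πs n)) := by
    intro n
    have := hmax (πs n)
    simp only [fDag]
    linarith
  have h2 : ∀ n, 0 ≤ s₀ - (w (πs n) - fDag S κ a (2 * ε) 0 π₀ ρ (πs n)) := fun n =>
    (mul_nonneg hε.le (tataru_nonneg S κ _ _)).trans (h1 n)
  have h3 := hlim.const_sub s₀
  have h4 : s = s₀ := le_antisymm (by linarith [ge_of_tendsto' h3 h2]) hs
  rw [h4, sub_self] at h3
  have h5 : Tendsto (fun n => ε * tataru S κ (πs n) π₀) atTop (𝓝 0) :=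
    squeeze_zero (fun n => mul_nonneg hε.le (tataru_nonneg S κ _ _)) h1 h3
  have h6 : Tendsto (fun n => tataru S κ (πs n) π₀) atTop (𝓝 0) := by
    have := h5.const_mul ε⁻¹
    simpa [inv_mul_cancel_left₀ hε.ne'] using this
  have h7 := hflow.tendsto_of_tataru h6
  refine ⟨h7, ?_⟩
  have hf : Continuous (fun π => fDag S κ a (2 * ε) 0 π₀ ρ π) := by
    have := continuous_tataru S κ π₀
    unfold fDag
    fun_prop
  have h8 := hlim.add ((hf.tendsto π₀).comp h7)
  have h9 : s + fDag S κ a (2 * ε) 0 π₀ ρ π₀ = w π₀ := by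
    simp only [fDag, h4, hs₀, hflow.tataru_self]; ring
  rw [h9] at h8
  simpa using h8

/-- A subsolution satisfies the subsolution inequality at a penalized maximum, and such a
point has finite energy. -/
theorem IsViscositySubsolution.le_of_penalized_max (hflow : IsEVIFlow En κ S)
    (hbot : ∀ π : E, En π ≠ ⊥) (hlsc : LowerSemicontinuous En) {lam : ℝ} (hlam : 0 < lam)
    {hd u : E → ℝ} (hhd : Continuous hd) (hu : IsViscositySubsolution En κ S lam hd u)
    {a ε : ℝ} (ha : 0 < a) (hε : 0 < ε) {ρ π₀ : E} (hρ : En ρ < ⊤)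
    (hmax : ∀ π, u π - a / 2 * dist π ρ ^ 2 ≤
      u π₀ - a / 2 * dist π₀ ρ ^ 2 + ε * tataru S κ π π₀) :
    En π₀ < ⊤ ∧ u π₀ ≤ hd π₀ + lam * (a * ((En ρ).toReal - (En π₀).toReal) +
      (-(a * (κ / 2)) * dist π₀ ρ ^ 2 + 2 * ε + a ^ 2 / 2 * dist π₀ ρ ^ 2
      + a * (2 * ε) * dist π₀ ρ + (2 * ε) ^ 2 / 2)) := by
  obtain ⟨⟨M, hM⟩, -, hu⟩ := hu
  obtain ⟨πs, hlim, hsup⟩ := hu a (2 * ε) 0 ha (by positivity) π₀ ρ hρ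
  obtain ⟨h1, h2⟩ := hflow.tendsto_of_penalized_max hε hmax (by
    have hb : BddAbove (Set.range fun π => u π - fDag S κ a (2 * ε) 0 π₀ ρ π) := by
      refine ⟨M, ?_⟩
      rintro _ ⟨π, rfl⟩
      have h1 := tataru_nonneg S κ π π₀
      have h2 := le_of_abs_le (hM π)
      have : 0 ≤ fDag S κ a (2 * ε) 0 π₀ ρ π := by unfold fDag; positivity
      simp only
      linarith
    have := le_ciSup hb π₀
    simp only [fDag, hflow.tataru_self] at this ⊢
    simpa using this) hlim
  set st : E → ℝ := fun π => -(a * (κ / 2)) * dist π ρ ^ 2 + 2 * ε + a ^ 2 / 2 * dist π ρ ^ 2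
      + a * (2 * ε) * dist π ρ + (2 * ε) ^ 2 / 2 with hst
  have hstc : Continuous st := by fun_prop
  have hmain : ∀ m : ℝ, (m : EReal) < En π₀ →
      (u π₀ - lam * (a * (En ρ).toReal + st π₀) - hd π₀) + lam * a * m ≤ 0 := by
    intro m hm
    refine le_of_forall_pos_le_add fun η hη => ?_
    have hlim2 : Tendsto (fun n => u (πs n) - lam * (a * ((En ρ).toReal - m) + st (πs n))
        - hd (πs n)) atTop (𝓝 (u π₀ - lam * (a * ((En ρ).toReal - m) + st π₀) - hd π₀)) :=
      (h2.sub ((((hstc.tendsto π₀).comp h1).const_add _).const_mul lam)).sub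
        ((hhd.tendsto π₀).comp h1)
    have hev := eventually_lt_of_limsup_lt
      (lt_of_le_of_lt hsup (show (0 : EReal) < (η : EReal) by exact_mod_cast hη))
    have := le_of_tendsto (b := η) hlim2 (by
      filter_upwards [hev, h1.eventually (hlsc π₀ _ hm)] with n hn hmn
      have hfin : En (πs n) ≠ ⊤ := by
        intro htop
        rw [gDag, htop, EReal.sub_top, EReal.coe_mul_bot_of_pos ha, EReal.bot_add,
          EReal.coe_mul_bot_of_pos hlam, EReal.sub_bot (EReal.coe_ne_bot _), EReal.top_sub_coe] at hn
        exact absurd hn (by simp)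
      rw [gDag, ← EReal.coe_toReal hρ.ne (hbot ρ), ← EReal.coe_toReal hfin (hbot _)] at hn
      rw [← EReal.coe_toReal hfin (hbot _)] at hmn
      norm_cast at hn hmn
      have h5 : lam * a * m < lam * a * (En (πs n)).toReal :=
        mul_lt_mul_of_pos_left hmn (by positivity)
      simp only [hst]
      linarith)
    linarith
  obtain ⟨h3, h4⟩ := EReal.lt_top_and_mul_toReal_le (hbot π₀) (mul_pos hlam ha) hmain
  refine ⟨h3, ?_⟩
  simp only [hst] at h4
  linarith

/-- A supersolution satisfies the supersolution inequality at a penalized minimum, and such a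
point has finite energy. -/
theorem IsViscositySupersolution.ge_of_penalized_min (hflow : IsEVIFlow En κ S)
    (hbot : ∀ π : E, En π ≠ ⊥) (hlsc : LowerSemicontinuous En) {lam : ℝ} (hlam : 0 < lam)
    {hd v : E → ℝ} (hhd : Continuous hd) (hv : IsViscositySupersolution En κ S lam hd v)
    {a ε : ℝ} (ha : 0 < a) (hε : 0 < ε) {γ μ₀ : E} (hγ : En γ < ⊤)
    (hmax : ∀ μ, -v μ - a / 2 * dist μ γ ^ 2 ≤
      -v μ₀ - a / 2 * dist μ₀ γ ^ 2 + ε * tataru S κ μ μ₀) :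
    En μ₀ < ⊤ ∧ hd μ₀ + lam * (a * ((En μ₀).toReal - (En γ).toReal) +
      (a * (κ / 2) * dist γ μ₀ ^ 2 - 2 * ε + a ^ 2 / 2 * dist γ μ₀ ^ 2
      - a * (2 * ε) * dist γ μ₀ - (2 * ε) ^ 2 / 2)) ≤ v μ₀ := by
  obtain ⟨⟨M, hM⟩, -, hv⟩ := hv
  obtain ⟨πs, hlim, hinf⟩ := hv a (2 * ε) 0 ha (by positivity) μ₀ γ hγ
  have hneg : ∀ μ, -v μ - fDag S κ a (2 * ε) 0 μ₀ γ μ = -(v μ - fDdag S κ a (2 * ε) 0 μ₀ γ μ) := by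
    intro μ
    simp only [fDag, fDdag, dist_comm γ μ]
    ring
  obtain ⟨h1, h2⟩ := hflow.tendsto_of_penalized_max (w := fun μ => -v μ)
    (s := -(⨅ μ : E, (v μ - fDdag S κ a (2 * ε) 0 μ₀ γ μ))) (πs := πs) hε hmax (by
    have hb : BddBelow (Set.range fun μ => v μ - fDdag S κ a (2 * ε) 0 μ₀ γ μ) := by
      refine ⟨-M, ?_⟩
      rintro _ ⟨μ, rfl⟩
      have h1 := tataru_nonneg S κ μ μ₀
      have h2 := neg_le_of_abs_le (hM μ)
      have : 0 ≤ fDag S κ a (2 * ε) 0 μ₀ γ μ := by unfold fDag; positivity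
      simp only
      linarith [hneg μ]
    have := ciInf_le hb μ₀
    have h3 := hneg μ₀
    simp only [fDag, hflow.tataru_self] at this h3 ⊢
    linarith) (by
    simp only [hneg]
    exact hlim.neg)
  have h2 : Tendsto (fun n => v (πs n)) atTop (𝓝 (v μ₀)) := by simpa using h2.neg
  set st : E → ℝ := fun μ => a * (κ / 2) * dist γ μ ^ 2 - 2 * ε + a ^ 2 / 2 * dist γ μ ^ 2
      - a * (2 * ε) * dist γ μ - (2 * ε) ^ 2 / 2 with hst
  have hstc : Continuous st := by fun_prop
  have hmain : ∀ m : ℝ, (m : EReal) < En μ₀ →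
      (hd μ₀ + lam * (a * (-(En γ).toReal) + st μ₀) - v μ₀) + lam * a * m ≤ 0 := by
    intro m hm
    refine le_of_forall_pos_le_add fun η hη => ?_
    have hlim2 : Tendsto (fun n => v (πs n) - lam * (a * (m - (En γ).toReal) + st (πs n))
        - hd (πs n)) atTop (𝓝 (v μ₀ - lam * (a * (m - (En γ).toReal) + st μ₀) - hd μ₀)) :=
      (h2.sub ((((hstc.tendsto μ₀).comp h1).const_add _).const_mul lam)).sub
        ((hhd.tendsto μ₀).comp h1)
    have hev := eventually_lt_of_lt_liminf
      (lt_of_lt_of_le (show ((-η : ℝ) : EReal) < (0 : EReal) by exact_mod_cast neg_lt_zero.2 hη) hinf)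
    have := ge_of_tendsto (b := -η) hlim2 (by
      filter_upwards [hev, h1.eventually (hlsc μ₀ _ hm)] with n hn hmn
      have hfin : En (πs n) ≠ ⊤ := by
        intro htop
        rw [gDdag, htop, ← EReal.coe_toReal hγ.ne (hbot γ), EReal.top_sub_coe,
          EReal.coe_mul_top_of_pos ha, EReal.top_add_coe,
          EReal.coe_mul_top_of_pos hlam, EReal.sub_top, EReal.bot_sub] at hn
        exact absurd hn (by simp)
      rw [gDdag, ← EReal.coe_toReal hγ.ne (hbot γ), ← EReal.coe_toReal hfin (hbot _)] at hn
      rw [← EReal.coe_toReal hfin (hbot _)] at hmn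
      norm_cast at hn hmn
      have h5 : lam * a * m < lam * a * (En (πs n)).toReal :=
        mul_lt_mul_of_pos_left hmn (by positivity)
      simp only [hst]
      linarith)
    linarith
  obtain ⟨h3, h4⟩ := EReal.lt_top_and_mul_toReal_le (hbot μ₀) (mul_pos hlam ha) hmain
  refine ⟨h3, ?_⟩
  simp only [hst] at h4
  linarith

end Flow

section Flow

variable {E : Type*} [MetricSpace E] {En : E → EReal} {κ : ℝ} {S : ℝ → E → E}

/-- First order optimality along the flow. -/
theorem IsEVIFlow.le_of_optimal_flow (hflow : IsEVIFlow En κ S) (hbot : ∀ π : E, En π ≠ ⊥)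
    (hlsc : LowerSemicontinuous En) {a δ ε K : ℝ} (ha : 0 < a) (hδ : 0 < δ) (hε : 0 < ε)
    (hK : 0 ≤ K) {x₀ π ρ μ : E} (hx₀ : En x₀ < ⊤) (hπ : En π < ⊤) (hρ : En ρ < ⊤)
    (hμ : En μ < ⊤)
    (hopt : ∀ ρ', En ρ' < ⊤ →
      a / 2 * dist ρ π ^ 2 + a / 2 * dist ρ μ ^ 2 + δ * ((En ρ).toReal + K * dist ρ x₀ ^ 2) ≤
      a / 2 * dist ρ' π ^ 2 + a / 2 * dist ρ' μ ^ 2 + δ * ((En ρ').toReal + K * dist ρ' x₀ ^ 2)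
        + ε * tataru S κ ρ' ρ)
    {L : ℝ} (hL : 0 ≤ L) (hLρ : L = 0 ∨ ENNReal.ofReal L < localSlope En ρ) :
    a * (2 * (En ρ).toReal - (En π).toReal - (En μ).toReal) + δ * L ^ 2 / 4 ≤
      -(a * (κ / 2)) * (dist ρ π ^ 2 + dist ρ μ ^ 2) +
      δ * K * (2 * ((En x₀).toReal - (En ρ).toReal) - κ * dist ρ x₀ ^ 2) + ε := by
  have hden : 0 < a + δ * K := by positivity
  refine le_of_forall_pos_le_add fun η' hη' => ?_
  obtain ⟨η, hη, hηη⟩ : ∃ η, 0 < η ∧ η * (a + δ * K) = η' :=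
    ⟨η' / (a + δ * K), by positivity, by field_simp⟩
  have hsl : ∀ z, En z < ⊤ → ∀ᶠ s in 𝓝[>] (0 : ℝ), dist (S s ρ) z ^ 2 ≤
      dist ρ z ^ 2 + s * (2 * ((En z).toReal - (En ρ).toReal) - κ * dist ρ z ^ 2 + η) := by
    intro z hz
    have := (hflow.evi ρ).eventually_slope_lt hbot hz le_rfl (by rwa [hflow.id0])
      (r := 2 * ((En z).toReal - (En ρ).toReal) - κ * dist ρ z ^ 2 + η)
      (by rw [hflow.id0]; linarith)
    filter_upwards [this, self_mem_nhdsWithin] with s hs hs0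
    have hs0 : 0 < s := hs0
    rw [slope_def_field, sub_zero, div_lt_iff₀ hs0, hflow.id0] at hs
    linarith
  obtain ⟨s, hs, ⟨h1, h2, h3⟩, hs0⟩ := ((hflow.frequently_energy_le hbot hlsc hρ hL hLρ).and_eventually
    (((hsl π hπ).and ((hsl μ hμ).and (hsl x₀ hx₀))).and self_mem_nhdsWithin)).exists
  have hs0 : 0 < s := hs0
  have h4 := hopt _ (hflow.energy_lt_top ρ hs0)
  have h5 := mul_le_mul_of_nonneg_left (tataru_flow_le S κ ρ hs0.le) hε.le
  have h6 := mul_le_mul_of_nonneg_left h1 (half_pos ha).le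
  have h7 := mul_le_mul_of_nonneg_left h2 (half_pos ha).le
  have h8 := mul_le_mul_of_nonneg_left h3 (mul_nonneg hδ.le hK)
  have h9 := mul_le_mul_of_nonneg_left hs hδ.le
  rw [← hηη]
  refine le_of_mul_le_mul_left ?_ hs0
  linarith

/-- First order optimality along regularized geodesics. -/
theorem IsEVIFlow.le_of_optimal_geodesic (hflow : IsEVIFlow En κ S) (hbot : ∀ π : E, En π ≠ ⊥)
    (hreg : RegularizedGeodesics En) {a δ ε K : ℝ} (ha : 0 < a) (hδ : 0 < δ)
    (hε : 0 < ε) (hK : 0 ≤ K) {x₀ π ρ μ : E} (hπ : En π < ⊤) (hρ : En ρ < ⊤)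
    (hopt : ∀ ρ', En ρ' < ⊤ →
      a / 2 * dist ρ π ^ 2 + a / 2 * dist ρ μ ^ 2 + δ * ((En ρ).toReal + K * dist ρ x₀ ^ 2) ≤
      a / 2 * dist ρ' π ^ 2 + a / 2 * dist ρ' μ ^ 2 + δ * ((En ρ').toReal + K * dist ρ' x₀ ^ 2)
        + ε * tataru S κ ρ' ρ)
    (hslope : localSlope En ρ < ⊤) :
    a * dist ρ π ≤
      a * dist ρ μ + (δ * (localSlope En ρ).toReal + 2 * δ * K * dist ρ x₀ + ε) := by
  obtain ⟨γ, hγ0, hγ1, hγ, hγθ⟩ := hreg ρ π (ENNReal.pow_lt_top hslope) hπ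
  set l := (localSlope En ρ).toReal with hl
  have hl0 : 0 ≤ l := ENNReal.toReal_nonneg
  set q := dist ρ π
  set p := dist ρ μ
  set r := dist ρ x₀
  have hq0 : 0 ≤ q := dist_nonneg
  have hp0 : 0 ≤ p := dist_nonneg
  have hr0 : 0 ≤ r := dist_nonneg
  have hlS : ((localSlope En ρ : ℝ≥0∞) : EReal) = ((l : ℝ) : EReal) := by
    rw [hl, ← EReal.toReal_coe_ennreal, EReal.coe_toReal (by simpa using hslope.ne)
      (EReal.coe_ennreal_ne_bot _)]
  have hbr : ∀ θ > 0, 0 ≤ a / 2 * (-2 * q * (q - 2 * θ) + θ * (q - 2 * θ) ^ 2)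
      + a / 2 * (2 * p * (q + 2 * θ) + θ * (q + 2 * θ) ^ 2) + δ * (l * (q + θ) + θ)
      + δ * K * (2 * r * (q + 2 * θ) + θ * (q + 2 * θ) ^ 2) + ε * (q + 2 * θ) := by
    intro θ hθ
    obtain ⟨-, -, γθ, hsup, hinf⟩ := hγθ θ hθ
    have h1 := eventually_lt_of_limsup_lt
      (lt_of_le_of_lt hsup (show ((θ : ℝ) : EReal) < ((2 * θ : ℝ) : EReal) by
        exact_mod_cast (by linarith : θ < 2 * θ)))
    rw [hlS] at hinf
    have h2 := frequently_lt_of_liminf_lt (by isBoundedDefault)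
      (lt_of_le_of_lt hinf (show ((l : ℝ) : EReal) * ((q + θ : ℝ) : EReal) <
        ((l * (q + θ) + θ : ℝ) : EReal) by exact_mod_cast lt_add_of_pos_right _ hθ))
    obtain ⟨t, ht2, ht1, ht⟩ := (h2.and_eventually (h1.and
      (Ioo_mem_nhdsGT (lt_min one_pos hθ)))).exists
    have ht0 : 0 < t := ht.1
    have ht1' : t < 1 := ht.2.trans_le (min_le_left _ _)
    have htθ : t < θ := ht.2.trans_le (min_le_right _ _)
    have ht1 : dist (γθ t) (γ t) / t < 2 * θ := by exact_mod_cast ht1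
    rw [div_lt_iff₀ ht0] at ht1
    have htinv : 0 < 1 / t := by positivity
    have hfin : En (γθ t) < ⊤ := by
      refine lt_top_iff_ne_top.2 fun htop => ?_
      rw [htop, ← EReal.coe_toReal hρ.ne (hbot ρ), EReal.top_sub_coe,
        EReal.top_mul_coe_of_pos htinv] at ht2
      exact absurd ht2 (by simp)
    rw [← EReal.coe_toReal hρ.ne (hbot ρ), ← EReal.coe_toReal hfin.ne (hbot _)] at ht2
    norm_cast at ht2
    rw [mul_one_div, div_lt_iff₀ ht0] at ht2
    have hd0 : dist ρ (γ t) = t * q := by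
      have := hγ 0 (by simp) t ⟨ht0.le, ht1'.le⟩
      rwa [hγ0, sub_zero, abs_of_pos ht0] at this
    have hd1 : dist (γ t) π = (1 - t) * q := by
      have := hγ t ⟨ht0.le, ht1'.le⟩ 1 (by simp)
      rwa [hγ1, abs_of_pos (by linarith)] at this
    have hρ' : dist (γθ t) ρ ≤ t * (q + 2 * θ) := by
      have := dist_triangle_right (γθ t) ρ (γ t)
      linarith
    have hX : dist (γθ t) π ≤ q - t * (q - 2 * θ) := by
      have := dist_triangle (γθ t) (γ t) π
      linarith
    have hY : dist (γθ t) μ ≤ p + t * (q + 2 * θ) := by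
      linarith [dist_triangle (γθ t) ρ μ]
    have hZ : dist (γθ t) x₀ ≤ r + t * (q + 2 * θ) := by
      linarith [dist_triangle (γθ t) ρ x₀]
    have hX2 := mul_le_mul_of_nonneg_left (pow_le_pow_left₀ dist_nonneg hX 2) (half_pos ha).le
    have hY2 := mul_le_mul_of_nonneg_left (pow_le_pow_left₀ dist_nonneg hY 2) (half_pos ha).le
    have hZ2 := mul_le_mul_of_nonneg_left (pow_le_pow_left₀ dist_nonneg hZ 2)
      (mul_nonneg hδ.le hK)
    have hT := mul_le_mul_of_nonneg_left ((hflow.tataru_le_dist (γθ t) ρ).trans hρ') hε.le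
    have hE := mul_le_mul_of_nonneg_left ht2.le hδ.le
    have ho := hopt _ hfin
    have hpos : 0 ≤ t * (a / 2 * (-2 * q * (q - 2 * θ) + t * (q - 2 * θ) ^ 2)
      + a / 2 * (2 * p * (q + 2 * θ) + t * (q + 2 * θ) ^ 2) + δ * (l * (q + θ) + θ)
      + δ * K * (2 * r * (q + 2 * θ) + t * (q + 2 * θ) ^ 2) + ε * (q + 2 * θ)) := by
      linarith
    refine (nonneg_of_mul_nonneg_right hpos ht0).trans ?_
    gcongr
  have hlim := ge_of_tendsto (x := 𝓝[>] (0 : ℝ)) (b := (0 : ℝ))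
    (f := fun θ => a / 2 * (-2 * q * (q - 2 * θ) + θ * (q - 2 * θ) ^ 2)
      + a / 2 * (2 * p * (q + 2 * θ) + θ * (q + 2 * θ) ^ 2) + δ * (l * (q + θ) + θ)
      + δ * K * (2 * r * (q + 2 * θ) + θ * (q + 2 * θ) ^ 2) + ε * (q + 2 * θ))
    ((Continuous.tendsto (by fun_prop) 0).mono_left nhdsWithin_le_nhds)
    (by filter_upwards [self_mem_nhdsWithin] with θ hθ using hbr θ hθ)
  rcases hq0.eq_or_lt with hq | hq
  · rw [← hq, mul_zero]
    positivity
  · refine le_of_mul_le_mul_left ?_ hq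
    linarith

/-- The estimate on the difference of Hamiltonians at an optimal triple. -/
theorem IsEVIFlow.hamiltonian_difference_le (hflow : IsEVIFlow En κ S) (hbot : ∀ π : E, En π ≠ ⊥)
    (hlsc : LowerSemicontinuous En) (hreg : RegularizedGeodesics En) {a δ ε K : ℝ} (ha : 0 < a)
    (hδ : 0 < δ) (hδ' : δ ≤ 1 / 8) (hε : 0 < ε) (hK : 0 ≤ K) {x₀ π ρ μ : E}
    (hx₀ : En x₀ < ⊤) (hπ : En π < ⊤) (hρ : En ρ < ⊤) (hμ : En μ < ⊤)
    (hopt : ∀ ρ', En ρ' < ⊤ →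
      a / 2 * dist ρ π ^ 2 + a / 2 * dist ρ μ ^ 2 + δ * ((En ρ).toReal + K * dist ρ x₀ ^ 2) ≤
      a / 2 * dist ρ' π ^ 2 + a / 2 * dist ρ' μ ^ 2 + δ * ((En ρ').toReal + K * dist ρ' x₀ ^ 2)
        + ε * tataru S κ ρ' ρ) :
    a * (2 * (En ρ).toReal - (En π).toReal - (En μ).toReal)
      + a ^ 2 / 2 * (dist ρ π ^ 2 - dist ρ μ ^ 2) ≤
      -(a * (κ / 2)) * (dist ρ π ^ 2 + dist ρ μ ^ 2) +
      δ * K * (2 * ((En x₀).toReal - (En ρ).toReal) - κ * dist ρ x₀ ^ 2) + ε +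
      (a * dist ρ μ * (2 * δ * K * dist ρ x₀ + ε) + 2 * δ * a ^ 2 * dist ρ μ ^ 2 +
        (2 * δ * K * dist ρ x₀ + ε) ^ 2) := by
  have hA := fun {L : ℝ} => hflow.le_of_optimal_flow hbot hlsc ha hδ hε hK hx₀ hπ hρ hμ hopt (L := L)
  set c := -(a * (κ / 2)) * (dist ρ π ^ 2 + dist ρ μ ^ 2) +
      δ * K * (2 * ((En x₀).toReal - (En ρ).toReal) - κ * dist ρ x₀ ^ 2) + ε
  set e := a * (2 * (En ρ).toReal - (En π).toReal - (En μ).toReal)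
  have hslope : localSlope En ρ < ⊤ := by
    refine lt_top_iff_ne_top.2 fun htop => ?_
    have h1 := hA (L := 1 + 4 * |c - e| / δ) (by positivity)
      (Or.inr (by rw [htop]; exact ENNReal.ofReal_lt_top))
    have h2 := le_abs_self (c - e)
    have h3 : δ * (4 * |c - e| / δ) = 4 * |c - e| := by field_simp
    have h4 : 0 ≤ 4 * |c - e| / δ := by positivity
    nlinarith [mul_nonneg hδ.le (sq_nonneg (4 * |c - e| / δ))]
  have hB := hflow.le_of_optimal_geodesic hbot hreg ha hδ hε hK hπ hρ hopt hslope
  set l := (localSlope En ρ).toReal with hl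
  have hl0 : 0 ≤ l := ENNReal.toReal_nonneg
  have hAl : e + δ * l ^ 2 / 4 ≤ c := by
    rcases hl0.eq_or_lt with h | h
    · rw [← h]; exact hA le_rfl (Or.inl rfl)
    · refine le_of_tendsto (x := 𝓝[<] l) (f := fun L => e + δ * L ^ 2 / 4)
        ((Continuous.tendsto (by fun_prop) l).mono_left nhdsWithin_le_nhds) ?_
      filter_upwards [Ioo_mem_nhdsLT h] with L hL
      exact hA hL.1.le (Or.inr ((ENNReal.ofReal_lt_iff_lt_toReal hL.1.le hslope.ne).2 hL.2))
  set q := dist ρ π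
  set p := dist ρ μ
  have hq0 : 0 ≤ q := dist_nonneg
  have hp0 : 0 ≤ p := dist_nonneg
  set w := 2 * δ * K * dist ρ x₀ + ε with hw
  have hw0 : 0 ≤ w := by positivity
  have h1 : (a * q) ^ 2 ≤ (a * p + (δ * l + w)) ^ 2 :=
    pow_le_pow_left₀ (by positivity) (by linarith) 2
  have h2 : 0 ≤ δ * (l / 2 - 2 * (a * p)) ^ 2 := by positivity
  have h3 : 0 ≤ (δ * l - w) ^ 2 := sq_nonneg _
  have h4 : δ * (δ * l ^ 2) ≤ 1 / 8 * (δ * l ^ 2) :=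
    mul_le_mul_of_nonneg_right hδ' (by positivity)
  nlinarith

end Flow

theorem Antitone.exists_sub_succ_le {g : ℕ → ℝ} (hg : Antitone g) (hb : BddBelow (Set.range g))
    {η : ℝ} (hη : 0 < η) : ∃ k, g k - g (k + 1) ≤ η := by
  have h := tendsto_atTop_ciInf hg hb
  have h1 := h.sub ((tendsto_add_atTop_iff_nat 1).2 h)
  rw [sub_self] at h1
  obtain ⟨k, hk⟩ := (h1.eventually (gt_mem_nhds hη)).exists
  exact ⟨k, hk.le⟩

/-- Smallness of the error terms in the comparison proof. -/
theorem error_terms_le {a K C κ e₀ e q p r τ η : ℝ} (ha : 0 < a) (hK : 0 ≤ K) (hC : 0 ≤ C)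
    (hq : 0 ≤ q) (hp : 0 ≤ p) (hr : 0 ≤ r) (hq1 : q ≤ 1) (hp1 : p ≤ 1) (hτ : 0 < τ) (hτ1 : τ ≤ 1)
    (hη : 2 * η ≤ 1) (hrη : τ ^ 2 * r ^ 2 ≤ 2 * η) (hqp : a * (q ^ 2 + p ^ 2) ≤ 12 * η)
    (he : -e ≤ K * r ^ 2 + C) :
    -(a * κ) * (q ^ 2 + p ^ 2) + τ ^ 2 * K * (2 * (e₀ - e) - κ * r ^ 2) + 5 * τ ^ 2
      + 2 * a * τ ^ 2 * (q + p) + 4 * (τ ^ 2) ^ 2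
      + (a * p * (2 * τ ^ 2 * K * r + τ ^ 2) + 2 * τ ^ 2 * a ^ 2 * p ^ 2
        + (2 * τ ^ 2 * K * r + τ ^ 2) ^ 2) ≤
    (12 * |κ| + 2 * K * (2 * K + |κ|)) * η +
      τ * (K * (2 * |e₀| + 2 * C) + 9 + 4 * a + a * (2 * K + 1) + 2 * a ^ 2 + (2 * K + 1) ^ 2) := by
  have hττ : τ ^ 2 ≤ τ := by nlinarith
  have hτ4 : (τ ^ 2) ^ 2 ≤ τ := by nlinarith [sq_nonneg τ]
  have hτr : τ ^ 2 * r ≤ τ := by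
    have : τ * r ≤ 1 := by
      have h : (τ * r) ^ 2 ≤ 1 ^ 2 := by rw [mul_pow]; linarith
      exact le_of_sq_le_sq h zero_le_one
    nlinarith
  have hw : 2 * τ ^ 2 * K * r + τ ^ 2 ≤ (2 * K + 1) * τ := by
    have := mul_le_mul_of_nonneg_left hτr hK
    linarith
  have hw0 : 0 ≤ 2 * τ ^ 2 * K * r + τ ^ 2 := by positivity
  have hw2 : (2 * τ ^ 2 * K * r + τ ^ 2) ^ 2 ≤ (2 * K + 1) ^ 2 * τ := by
    have h1 := pow_le_pow_left₀ hw0 hw 2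
    rw [mul_pow] at h1
    exact h1.trans (mul_le_mul_of_nonneg_left hττ (by positivity))
  have h1 : -(a * κ) * (q ^ 2 + p ^ 2) ≤ |κ| * (12 * η) := by
    have h2 : 0 ≤ a * (q ^ 2 + p ^ 2) := by positivity
    have h3 := mul_le_mul_of_nonneg_left hqp (abs_nonneg κ)
    have h4 := mul_le_mul_of_nonneg_right (neg_le_abs κ) h2
    linarith
  have h2 : τ ^ 2 * K * (2 * (e₀ - e) - κ * r ^ 2) ≤
      τ * (K * (2 * |e₀| + 2 * C)) + K * (2 * K + |κ|) * (2 * η) := by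
    have h3 : 2 * (e₀ - e) - κ * r ^ 2 ≤ (2 * |e₀| + 2 * C) + (2 * K + |κ|) * r ^ 2 := by
      have h4 := mul_le_mul_of_nonneg_right (neg_le_abs κ) (sq_nonneg r)
      have h5 := le_abs_self e₀
      linarith
    have h4 := mul_le_mul_of_nonneg_left h3 (show 0 ≤ τ ^ 2 * K by positivity)
    have h5 := mul_le_mul_of_nonneg_right hττ (show 0 ≤ K * (2 * |e₀| + 2 * C) by positivity)
    have h6 := mul_le_mul_of_nonneg_left hrη (show 0 ≤ K * (2 * K + |κ|) by positivity)
    linarith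
  have h3 : 2 * a * τ ^ 2 * (q + p) ≤ τ * (4 * a) := by
    have h4 : a * τ ^ 2 * (q + p) ≤ a * τ * 2 := by gcongr; linarith
    linarith
  have h4 : a * p * (2 * τ ^ 2 * K * r + τ ^ 2) ≤ a * 1 * ((2 * K + 1) * τ) := by gcongr
  have h5 : 2 * τ ^ 2 * a ^ 2 * p ^ 2 ≤ 2 * τ * a ^ 2 * 1 ^ 2 := by gcongr
  linarith

section Flow

variable {E : Type*} [MetricSpace E] {En : E → EReal} {κ : ℝ} {S : ℝ → E → E}

/-- The doubled and penalized functional of the comparison proof. -/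
noncomputable def penalized (En : E → EReal) (u v : E → ℝ) (a δ K C : ℝ) (x₀ : E)
    (x : E × E × E) : ℝ :=
  u x.1 - v x.2.2 - a / 2 * dist x.1 x.2.1 ^ 2 - a / 2 * dist x.2.2 x.2.1 ^ 2
    - δ * ((En x.2.1).toReal + K * dist x.2.1 x₀ ^ 2 + C)

/-- Existence of perturbed maximizers of the penalized functional. -/
theorem IsEVIFlow.exists_penalized_maximizer [CompleteSpace E] (hflow : IsEVIFlow En κ S)
    (hbot : ∀ π : E, En π ≠ ⊥) (hlsc : LowerSemicontinuous En) {u v : E → ℝ}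
    (hu : UpperSemicontinuous u) (hv : LowerSemicontinuous v) {M N : ℝ} (hM : ∀ π, |u π| ≤ M)
    (hN : ∀ π, |v π| ≤ N) {a δ ε K C : ℝ} (ha : 0 < a) (hδ : 0 < δ) (hε : 0 < ε) {x₀ : E}
    (hF : ∀ ρ, En ρ < ⊤ → 0 ≤ (En ρ).toReal + K * dist ρ x₀ ^ 2 + C) {y : E × E × E}
    (hy : En y.2.1 < ⊤) :
    ∃ x : E × E × E, En x.2.1 < ⊤ ∧
      penalized En u v a δ K C x₀ y ≤ penalized En u v a δ K C x₀ x ∧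
      ∀ z : E × E × E, En z.2.1 < ⊤ → penalized En u v a δ K C x₀ z ≤
        penalized En u v a δ K C x₀ x + ε * (tataru S κ z.1 x.1 + tataru S κ z.2.1 x.2.1
          + tataru S κ z.2.2 x.2.2) := by
  refine exists_almost_maximizer (X := E × E × E) (P := fun x => En x.2.1 < ⊤) (B := M + N)
    (D := fun z x => tataru S κ z.1 x.1 + tataru S κ z.2.1 x.2.1 + tataru S κ z.2.2 x.2.2)
    (fun x => by simp [hflow.tataru_self]) (fun x z w => ?_) (fun z => ?_) (fun x r hr h => ?_)
    (fun x z => ?_) (fun x z hP hmono hlim => ?_) (fun x hx => ?_) hy hε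
  · have h1 := hflow.tataru_triangle hbot hlsc x.1 z.1 w.1
    have h2 := hflow.tataru_triangle hbot hlsc x.2.1 z.2.1 w.2.1
    have h3 := hflow.tataru_triangle hbot hlsc x.2.2 z.2.2 w.2.2
    linarith
  · exact (((continuous_tataru S κ z.1).comp continuous_fst).add
      ((continuous_tataru S κ z.2.1).comp (continuous_fst.comp continuous_snd))).add
      ((continuous_tataru S κ z.2.2).comp (continuous_snd.comp continuous_snd))
  · have hnn := fun a b => tataru_nonneg S κ (a : E) (b : E)
    obtain ⟨y₁, h₁⟩ := hflow.exists_tendsto_of_tataru hbot hlsc (x := fun n => (x n).1) hr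
      (fun n => by linarith [h n, hnn (x (n + 1)).2.1 (x n).2.1, hnn (x (n + 1)).2.2 (x n).2.2])
    obtain ⟨y₂, h₂⟩ := hflow.exists_tendsto_of_tataru hbot hlsc (x := fun n => (x n).2.1) hr
      (fun n => by linarith [h n, hnn (x (n + 1)).1 (x n).1, hnn (x (n + 1)).2.2 (x n).2.2])
    obtain ⟨y₃, h₃⟩ := hflow.exists_tendsto_of_tataru hbot hlsc (x := fun n => (x n).2.2) hr
      (fun n => by linarith [h n, hnn (x (n + 1)).1 (x n).1, hnn (x (n + 1)).2.1 (x n).2.1])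
    exact ⟨(y₁, y₂, y₃), h₁.prodMk_nhds (h₂.prodMk_nhds h₃)⟩
  · have h1 := tataru_nonneg S κ x.1 z.1
    have h2 := tataru_nonneg S κ x.2.1 z.2.1
    have h3 := tataru_nonneg S κ x.2.2 z.2.2
    positivity
  · set st : E × E × E → ℝ := fun x =>
      a / 2 * dist x.1 x.2.1 ^ 2 + a / 2 * dist x.2.2 x.2.1 ^ 2
        + δ * (K * dist x.2.1 x₀ ^ 2 + C) with hst
    have hstc : Continuous st := by fun_prop
    have key : ∀ n, En z.2.1 < ⊤ ∧ (penalized En u v a δ K C x₀ (x n) - u z.1 + v z.2.2 + st z)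
        + δ * (En z.2.1).toReal ≤ 0 := by
      intro n
      refine EReal.lt_top_and_mul_toReal_le (hbot _) hδ fun m hm => ?_
      refine le_of_forall_pos_le_add fun η hη => ?_
      have h1 : ∀ᶠ k in atTop, u (x k).1 < u z.1 + η / 2 :=
        ((continuous_fst.tendsto z).comp hlim).eventually (hu z.1 _ (by linarith))
      have h2 : ∀ᶠ k in atTop, v z.2.2 - η / 2 < v (x k).2.2 :=
        (((continuous_snd.comp continuous_snd).tendsto z).comp hlim).eventually
          (hv z.2.2 _ (by simp only; linarith))
      have h3 : ∀ᶠ k in atTop, (m : EReal) < En (x k).2.1 :=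
        (((continuous_fst.comp continuous_snd).tendsto z).comp hlim).eventually
          (hlsc z.2.1 _ hm)
      have h4 := ge_of_tendsto (b := penalized En u v a δ K C x₀ (x n) - u z.1 + v z.2.2
        + δ * m - η) (((hstc.tendsto z).comp hlim).neg) (by
        filter_upwards [h1, h2, h3, eventually_ge_atTop n] with k h1 h2 h3 hk
        rw [← EReal.coe_toReal (hP k).ne (hbot _)] at h3
        have h3 := mul_lt_mul_of_pos_left (EReal.coe_lt_coe_iff.1 h3) hδ
        have h4 := hmono hk
        simp only [penalized, hst, Function.comp] at h4 ⊢
        linarith)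
      linarith
    refine ⟨(key 0).1, fun n => ?_⟩
    have := (key n).2
    simp only [penalized, hst] at this ⊢
    linarith
  · have h1 := le_of_abs_le (hM x.1)
    have h2 := neg_le_of_abs_le (hN x.2.2)
    have h3 := mul_nonneg hδ.le (hF _ hx)
    have h4 : 0 ≤ a / 2 * dist x.1 x.2.1 ^ 2 := by positivity
    have h5 : 0 ≤ a / 2 * dist x.2.2 x.2.1 ^ 2 := by positivity
    simp only [penalized]
    linarith

/-- The supremum of the functional with doubled variables. -/
noncomputable def doubledSup (En : E → EReal) (u v : E → ℝ) (a : ℝ) : ℝ :=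
  ⨆ x : {x : E × E × E // En x.2.1 < ⊤}, (u x.1.1 - v x.1.2.2
    - a / 2 * (dist x.1.1 x.1.2.1 ^ 2 + dist x.1.2.2 x.1.2.1 ^ 2))

theorem le_doubledSup {u v : E → ℝ} {M N : ℝ} (hM : ∀ π, |u π| ≤ M) (hN : ∀ π, |v π| ≤ N)
    {a : ℝ} (ha : 0 < a) {π ρ μ : E} (hρ : En ρ < ⊤) :
    u π - v μ - a / 2 * (dist π ρ ^ 2 + dist μ ρ ^ 2) ≤ doubledSup En u v a := by
  refine le_ciSup (f := fun x : {x : E × E × E // En x.2.1 < ⊤} => u x.1.1 - v x.1.2.2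
    - a / 2 * (dist x.1.1 x.1.2.1 ^ 2 + dist x.1.2.2 x.1.2.1 ^ 2)) ⟨M + N, ?_⟩ ⟨(π, ρ, μ), hρ⟩
  rintro _ ⟨x, rfl⟩
  have h1 := le_of_abs_le (hM x.1.1)
  have h2 := neg_le_of_abs_le (hN x.1.2.2)
  have h3 : 0 ≤ a / 2 * (dist x.1.1 x.1.2.1 ^ 2 + dist x.1.2.2 x.1.2.1 ^ 2) := by positivity
  simp only
  linarith

theorem IsEVIFlow.sub_le_doubledSup (hflow : IsEVIFlow En κ S) {u v : E → ℝ} {M N : ℝ}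
    (hM : ∀ π, |u π| ≤ M) (hN : ∀ π, |v π| ≤ N) {a : ℝ} (ha : 0 < a) (π : E) :
    u π - v π ≤ doubledSup En u v a := by
  have h1 : Tendsto (fun t => S t π) (𝓝[>] 0) (𝓝 π) :=
    (hflow.tendsto_zero π).mono_left (nhdsWithin_mono _ Set.Ioi_subset_Ici_self)
  have hc : Continuous fun ρ => u π - v π - a / 2 * (dist π ρ ^ 2 + dist π ρ ^ 2) := by fun_prop
  have h2 := (hc.tendsto π).comp h1
  have h3 := le_of_tendsto (b := doubledSup En u v a) h2 (by
    filter_upwards [self_mem_nhdsWithin] with t ht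
    exact le_doubledSup hM hN ha (hflow.energy_lt_top π ht))
  simpa using h3

theorem doubledSup_anti {u v : E → ℝ} {M N : ℝ} (hM : ∀ π, |u π| ≤ M) (hN : ∀ π, |v π| ≤ N)
    (hproper : ∃ π : E, En π < ⊤) {a b : ℝ} (ha : 0 < a) (hab : a ≤ b) :
    doubledSup En u v b ≤ doubledSup En u v a := by
  obtain ⟨x₀, hx₀⟩ := hproper
  have : Nonempty {x : E × E × E // En x.2.1 < ⊤} := ⟨⟨(x₀, x₀, x₀), hx₀⟩⟩
  refine ciSup_le fun x => le_trans ?_ (le_doubledSup hM hN ha (π := x.1.1) (μ := x.1.2.2) x.2)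
  gcongr

end Flow

section Flow

variable {E : Type*} [MetricSpace E] {En : E → EReal} {κ : ℝ} {S : ℝ → E → E}

/-- The comparison estimate at a perturbed maximizer of the penalized functional. -/
theorem IsEVIFlow.sub_le_of_penalized_maximizer (hflow : IsEVIFlow En κ S)
    (hbot : ∀ π : E, En π ≠ ⊥) (hlsc : LowerSemicontinuous En) (hreg : RegularizedGeodesics En)
    {lam : ℝ} (hlam : 0 < lam) {hdag hddag u v : E → ℝ} (hdag_cont : Continuous hdag)
    (hddag_cont : Continuous hddag) (hu : IsViscositySubsolution En κ S lam hdag u)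
    (hv : IsViscositySupersolution En κ S lam hddag v) {a δ ε K C : ℝ} (ha : 0 < a) (hδ : 0 < δ)
    (hδ' : δ ≤ 1 / 8) (hε : 0 < ε) (hK : 0 ≤ K) {x₀ π ρ μ : E} (hx₀ : En x₀ < ⊤) (hρ : En ρ < ⊤)
    (hmax : ∀ z : E × E × E, En z.2.1 < ⊤ → penalized En u v a δ K C x₀ z ≤
        penalized En u v a δ K C x₀ (π, ρ, μ) + ε * (tataru S κ z.1 π + tataru S κ z.2.1 ρ
          + tataru S κ z.2.2 μ)) :
    u π - v μ ≤ hdag π - hddag μ + lam *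
      (-(a * κ) * (dist ρ π ^ 2 + dist ρ μ ^ 2)
        + δ * K * (2 * ((En x₀).toReal - (En ρ).toReal) - κ * dist ρ x₀ ^ 2) + 5 * ε
        + 2 * a * ε * (dist ρ π + dist ρ μ) + 4 * ε ^ 2
        + (a * dist ρ μ * (2 * δ * K * dist ρ x₀ + ε) + 2 * δ * a ^ 2 * dist ρ μ ^ 2
          + (2 * δ * K * dist ρ x₀ + ε) ^ 2)) := by
  obtain ⟨hπ, h1⟩ := hu.le_of_penalized_max hflow hbot hlsc hlam hdag_cont ha hε hρ (π₀ := π)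
    (fun π' => by
      have := hmax (π', ρ, μ) hρ
      simp only [penalized, hflow.tataru_self] at this
      linarith)
  obtain ⟨hμ, h2⟩ := hv.ge_of_penalized_min hflow hbot hlsc hlam hddag_cont ha hε hρ (μ₀ := μ)
    (fun μ' => by
      have := hmax (π, ρ, μ') hρ
      simp only [penalized, hflow.tataru_self] at this
      linarith)
  have h3 := hflow.hamiltonian_difference_le hbot hlsc hreg ha hδ hδ' hε hK hx₀ hπ hρ hμ
    (fun ρ' hρ' => by
      have := hmax (π, ρ', μ) hρ'
      simp only [penalized, hflow.tataru_self] at this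
      rw [dist_comm ρ π, dist_comm ρ μ, dist_comm ρ' π, dist_comm ρ' μ]
      linarith)
  have h4 := mul_le_mul_of_nonneg_left h3 hlam.le
  rw [dist_comm π ρ] at h1
  linarith

/-- The comparison estimate with doubled variables: the value `u π - v μ` is almost maximal, the
points `π` and `μ` are close, and the Hamiltonian contribution is small. -/
theorem IsEVIFlow.exists_sub_le [CompleteSpace E] (hflow : IsEVIFlow En κ S)
    (hbot : ∀ π : E, En π ≠ ⊥) (hproper : ∃ π : E, En π < ⊤)
    (hlsc : LowerSemicontinuous En) (hreg : RegularizedGeodesics En)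
    {lam : ℝ} (hlam : 0 < lam) {hdag hddag u v : E → ℝ} (hdag_cont : Continuous hdag)
    (hddag_cont : Continuous hddag) (hu : IsViscositySubsolution En κ S lam hdag u)
    (hv : IsViscositySupersolution En κ S lam hddag v) {σ ω : ℝ} (hσ : 0 < σ) (hω : 0 < ω) :
    ∃ π μ : E, dist π μ < ω ∧ u π - v μ ≤ hdag π - hddag μ + σ ∧
      ∀ π', u π' - v π' ≤ u π - v μ + σ := by
  obtain ⟨M, hM⟩ := hu.1
  obtain ⟨N, hN⟩ := hv.1
  obtain ⟨x₀, hx₀⟩ := hproper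
  obtain ⟨C, K₀, hC, hK₀, hE⟩ := hflow.exists_energy_ge hbot hlsc hx₀
  set K := K₀ + 1 with hKdef
  have hK : 0 ≤ K := by positivity
  have hF : ∀ ρ, En ρ < ⊤ → dist ρ x₀ ^ 2 ≤ (En ρ).toReal + K * dist ρ x₀ ^ 2 + C := by
    intro ρ hρ
    linarith [hE ρ hρ]
  set L := 12 * |κ| + 2 * K * (2 * K + |κ|) with hL
  have hL0 : 0 ≤ L := by positivity
  obtain ⟨η, hη, hη1, hηω, hησ, hηL⟩ : ∃ η : ℝ, 0 < η ∧ 6 * η ≤ 1 ∧ 100 * η ≤ ω ^ 2 ∧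
      2 * η ≤ σ ∧ 2 * (lam * L) * η ≤ σ := by
    refine ⟨min (1 / 6) (min (ω ^ 2 / 100) (σ / (2 * (1 + lam * L)))), by positivity, ?_, ?_, ?_⟩
    · linarith [min_le_left (1 / 6 : ℝ) (min (ω ^ 2 / 100) (σ / (2 * (1 + lam * L))))]
    · linarith [(min_le_right (1 / 6 : ℝ) (min (ω ^ 2 / 100) (σ / (2 * (1 + lam * L))))).trans
        (min_le_left _ _)]
    · have h0 : 0 ≤ lam * L := by positivity
      have h1 := (min_le_right (1 / 6 : ℝ) (min (ω ^ 2 / 100) (σ / (2 * (1 + lam * L))))).trans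
        (min_le_right _ _)
      rw [le_div_iff₀ (by positivity)] at h1
      have h2 : 0 < min (1 / 6 : ℝ) (min (ω ^ 2 / 100) (σ / (2 * (1 + lam * L)))) := by positivity
      have h3 := mul_nonneg h0 h2.le
      constructor <;> linarith
  obtain ⟨a, ha, hadiff⟩ : ∃ a : ℝ, 2 ≤ a ∧
      doubledSup En u v (a / 2) - doubledSup En u v a ≤ η := by
    obtain ⟨k, hk⟩ := Antitone.exists_sub_succ_le (g := fun k => doubledSup En u v (2 ^ k))
      (antitone_nat_of_succ_le fun k => doubledSup_anti hM hN ⟨x₀, hx₀⟩ (by positivity)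
        (by rw [pow_succ]; linarith [pow_pos (two_pos : (0 : ℝ) < 2) k]))
      ⟨u x₀ - v x₀, by
        rintro _ ⟨k, rfl⟩
        exact hflow.sub_le_doubledSup hM hN (by positivity) x₀⟩ hη
    refine ⟨2 ^ (k + 1), ?_, ?_⟩
    · rw [pow_succ]; linarith [one_le_pow₀ (one_le_two : (1 : ℝ) ≤ 2) (n := k)]
    · rw [show (2 : ℝ) ^ (k + 1) / 2 = 2 ^ k by rw [pow_succ]; ring]
      exact hk
  have ha0 : 0 < a := by linarith
  obtain ⟨y, hyD, hy⟩ : ∃ y : E × E × E, En y.2.1 < ⊤ ∧ doubledSup En u v a - η <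
      u y.1 - v y.2.2 - a / 2 * (dist y.1 y.2.1 ^ 2 + dist y.2.2 y.2.1 ^ 2) := by
    have : Nonempty {x : E × E × E // En x.2.1 < ⊤} := ⟨⟨(x₀, x₀, x₀), hx₀⟩⟩
    obtain ⟨y, hy⟩ := exists_lt_of_lt_ciSup (sub_lt_self (doubledSup En u v a) hη)
    exact ⟨y.1, y.2, hy⟩
  set F := (En y.2.1).toReal + K * dist y.2.1 x₀ ^ 2 + C with hFdef
  have hF0 : 0 ≤ F := (sq_nonneg _).trans (hF _ hyD)
  set B := K * (2 * |(En x₀).toReal| + 2 * C) + 9 + 4 * a + a * (2 * K + 1) + 2 * a ^ 2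
    + (2 * K + 1) ^ 2 with hB
  have hB0 : 0 ≤ B := by positivity
  obtain ⟨τ, hτ, hτ1, hτF, hτB⟩ : ∃ τ : ℝ, 0 < τ ∧ 4 * τ ≤ 1 ∧ τ * F ≤ η ∧
      2 * (lam * B) * τ ≤ σ := by
    have h0 : 0 ≤ lam * B := by positivity
    refine ⟨min (1 / 4) (min (η / (1 + F)) (σ / (2 * (1 + lam * B)))), by positivity, ?_, ?_, ?_⟩
    · linarith [min_le_left (1 / 4 : ℝ) (min (η / (1 + F)) (σ / (2 * (1 + lam * B))))]
    · have h1 := (min_le_right (1 / 4 : ℝ) (min (η / (1 + F)) (σ / (2 * (1 + lam * B))))).trans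
        (min_le_left _ _)
      have h2 : 0 < min (1 / 4 : ℝ) (min (η / (1 + F)) (σ / (2 * (1 + lam * B)))) := by positivity
      rw [le_div_iff₀ (by positivity)] at h1
      linarith
    · have h1 := (min_le_right (1 / 4 : ℝ) (min (η / (1 + F)) (σ / (2 * (1 + lam * B))))).trans
        (min_le_right _ _)
      have h2 : 0 < min (1 / 4 : ℝ) (min (η / (1 + F)) (σ / (2 * (1 + lam * B)))) := by positivity
      rw [le_div_iff₀ (by positivity)] at h1
      linarith
  have hττ : τ ^ 2 ≤ τ / 4 := by nlinarith
  have hδ : 0 < τ ^ 2 := by positivity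
  obtain ⟨⟨π, ρ, μ⟩, hρ, hstart, hmax⟩ := hflow.exists_penalized_maximizer hbot hlsc hu.2.1 hv.2.1
    hM hN ha0 hδ hδ (K := K) (C := C) (x₀ := x₀) (fun ρ hρ => (sq_nonneg _).trans (hF ρ hρ)) hyD
  have hmain := hflow.sub_le_of_penalized_maximizer hbot hlsc hreg hlam hdag_cont hddag_cont hu hv
    ha0 hδ (by linarith) hδ hK hx₀ hρ hmax
  have hδF : τ ^ 2 * F ≤ η := (mul_le_mul_of_nonneg_right (by linarith) hF0).trans hτF
  have hρF := hF ρ hρ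
  simp only [penalized] at hstart hρ hρF
  rw [← hFdef] at hstart
  have h1 := le_doubledSup hM hN ha0 (π := π) (μ := μ) hρ
  have h2 := le_doubledSup hM hN (half_pos ha0) (π := π) (μ := μ) hρ
  rw [dist_comm π ρ, dist_comm μ ρ] at h1 h2 hstart
  have hq0 : 0 ≤ dist ρ π := dist_nonneg
  have hp0 : 0 ≤ dist ρ μ := dist_nonneg
  have hr0 : 0 ≤ dist ρ x₀ := dist_nonneg
  have htri := dist_triangle_left π μ ρ
  have he : -(En ρ).toReal ≤ K * dist ρ x₀ ^ 2 + C := by linarith [sq_nonneg (dist ρ x₀)]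
  set q := dist ρ π
  set p := dist ρ μ
  set r := dist ρ x₀
  have hδρ := mul_le_mul_of_nonneg_left hρF hδ.le
  have hδr0 : 0 ≤ τ ^ 2 * r ^ 2 := by positivity
  have hδr : τ ^ 2 * r ^ 2 ≤ 2 * η := by linarith
  have hqp : a * (q ^ 2 + p ^ 2) ≤ 12 * η := by linarith
  have h2qp : 2 * (q ^ 2 + p ^ 2) ≤ a * (q ^ 2 + p ^ 2) :=
    mul_le_mul_of_nonneg_right ha (by positivity)
  have hsq : ∀ x : ℝ, x ^ 2 ≤ 6 * η → x ≤ 1 ∧ x < ω / 2 := fun x hx =>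
    ⟨le_of_sq_le_sq (by linarith) zero_le_one, lt_of_pow_lt_pow_left₀ 2 (by positivity) (by
      rw [div_pow]; linarith [pow_pos hω 2])⟩
  obtain ⟨hq1, hqω⟩ := hsq q (by linarith [sq_nonneg p])
  obtain ⟨hp1, hpω⟩ := hsq p (by linarith [sq_nonneg q])
  have herr := mul_le_mul_of_nonneg_left (error_terms_le (κ := κ) (e₀ := (En x₀).toReal) ha0 hK hC
    hq0 hp0 hr0 hq1 hp1 hτ (by linarith) (by linarith) hδr hqp he) hlam.le
  rw [← hL, ← hB] at herr
  have hqp0 : 0 ≤ a * (q ^ 2 + p ^ 2) := by positivity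
  refine ⟨π, μ, by linarith, by linarith, fun π' => ?_⟩
  have := hflow.sub_le_doubledSup hM hN ha0 π'
  linarith

end Flow

/-- The comparison principle (Theorem 2.9). -/
theorem comparison_principle
    {E : Type*} [MetricSpace E] [CompleteSpace E]
    (hgeo : GeodesicSpace E)
    (En : E → EReal) (hbot : ∀ π : E, En π ≠ ⊥) (hproper : ∃ π : E, En π < ⊤)
    (hlsc : LowerSemicontinuous En)
    (κ : ℝ) (S : ℝ → E → E) (hflow : IsEVIFlow En κ S)
    (hreg : RegularizedGeodesics En)
    (lam : ℝ) (hlam : 0 < lam)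
    (hdag hddag : E → ℝ)
    (hdag_bdd : ∃ M : ℝ, ∀ π : E, |hdag π| ≤ M) (hdag_uc : UniformContinuous hdag)
    (hddag_bdd : ∃ M : ℝ, ∀ π : E, |hddag π| ≤ M) (hddag_uc : UniformContinuous hddag)
    (u v : E → ℝ)
    (hu : IsViscositySubsolution En κ S lam hdag u)
    (hv : IsViscositySupersolution En κ S lam hddag v) :
    (⨆ π : E, (u π - v π)) ≤ ⨆ π : E, (hdag π - hddag π) := by
  obtain ⟨M, hM⟩ := hdag_bdd
  obtain ⟨N, hN⟩ := hddag_bdd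
  have hb : BddAbove (Set.range fun π => hdag π - hddag π) := by
    refine ⟨M + N, ?_⟩
    rintro _ ⟨π, rfl⟩
    have h1 := le_of_abs_le (hM π)
    have h2 := neg_le_of_abs_le (hN π)
    simp only
    linarith
  have : Nonempty E := ⟨hproper.choose⟩
  refine ciSup_le fun π' => le_of_forall_pos_le_add fun σ hσ => ?_
  obtain ⟨ω, hω, hmod⟩ := Metric.uniformContinuous_iff.1 hdag_uc (σ / 3) (by positivity)
  obtain ⟨π, μ, hdist, hle, hmax⟩ := hflow.exists_sub_le hbot hproper hlsc hreg hlam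
    hdag_uc.continuous hddag_uc.continuous hu hv (σ := σ / 3) (by positivity) hω
  have h1 := hmax π'
  have h2 := le_of_abs_le (hmod hdist).le
  have h3 := le_ciSup hb μ
  linarith
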